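/- Let Q be a finite quiver without oriented cycles, n = (n_x)_{x∈Q0} a dimension vector, E_x = ℂ^{n_x}. Let λ = (λ_x)_{x∈Q0} be a dominant weight, i.e. each λ_x = (λ_x(1) ≥ … ≥ λ_x(n_x)) is a weakly decreasing sequence of integers. Then there exists r ∈ H_Q(E) with μ_x(r) = −diag(λ_x(1),…,λ_x(n_x)) for every x ∈ Q0 if and only if Σ_{x∈Q0} Σ_{j=1}^{n_x} λ_x(j) = 0 and Σ_{x∈Q0} Σ_{j∈K_x} λ_x(j) ≤ 0 for every family K = (K_x) that is Q-intersecting for n. -/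

import Mathlib

open Matrix

noncomputable section

/-- The standard flag subspace `span(e_1, …, e_j)` of `ℂ^n` (with 0-indexed coordinates,
this is the space of vectors vanishing on all coordinates `≥ j`). -/
def stdFlag (n j : ℕ) : Submodule ℂ (Fin n → ℂ) where
  carrier := {f | ∀ i : Fin n, j ≤ (i : ℕ) → f i = 0}
  add_mem' := by
    intro a b ha hb i hi
    simp only [Pi.add_apply, ha i hi, hb i hi, add_zero]
  zero_mem' := by intro i _; rfl
  smul_mem' := by
    intro c f hf i hi
    simp only [Pi.smul_apply, hf i hi, smul_zero]

/-- A quiver given by source and target maps has no oriented cycles. -/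
def NoCycles {V A : Type} (src tgt : A → V) : Prop :=
  ∀ (k : ℕ) (f : Fin (k + 1) → A),
    (∀ i : Fin k, tgt (f i.castSucc) = src (f i.succ)) →
    tgt (f (Fin.last k)) ≠ src (f 0)

/-- `α ≤_Q n` : every representation of the quiver on the spaces `ℂ^{n_x}` has a
subrepresentation of dimension vector `α`. -/
def HasSubrepOfDim {V A : Type} (src tgt : A → V) (n : V → ℕ) (α : V → ℕ) : Prop :=
  ∀ r : ∀ a : A, (Fin (n (src a)) → ℂ) →ₗ[ℂ] (Fin (n (tgt a)) → ℂ),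
    ∃ S : ∀ x : V, Submodule ℂ (Fin (n x) → ℂ),
      (∀ x : V, Module.finrank ℂ (S x) = α x) ∧
      (∀ a : A, (S (src a)).map (r a) ≤ S (tgt a))

/-- A family `K = (K_x)` of subsets `K_x ⊆ {1,…,n_x}` is `Q`-intersecting for `n` if every
representation of the quiver on the `ℂ^{n_x}` admits a subrepresentation `S` lying in the
Schubert variety indexed by `K` (w.r.t. the standard flags). -/
def IsQIntersecting {V A : Type} (src tgt : A → V) (n : V → ℕ)
    (K : ∀ x : V, Finset (Fin (n x))) : Prop :=
  ∀ r : ∀ a : A, (Fin (n (src a)) → ℂ) →ₗ[ℂ] (Fin (n (tgt a)) → ℂ),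
    ∃ S : ∀ x : V, Submodule ℂ (Fin (n x) → ℂ),
      (∀ x : V, Module.finrank ℂ (S x) = (K x).card) ∧
      (∀ x : V, ∀ j : Fin (K x).card,
        (j : ℕ) + 1 ≤ Module.finrank ℂ
          ((S x ⊓ stdFlag (n x) ((((K x).orderIsoOfFin rfl j : Fin (n x)) : ℕ) + 1) :
            Submodule ℂ (Fin (n x) → ℂ)))) ∧
      (∀ a : A, (S (src a)).map (r a) ≤ S (tgt a))

/-- The expected dimension `edim_{Q,B}(K, n)`. -/
def edimQB {V A : Type} [Fintype V] [Fintype A] (src tgt : A → V) (n : V → ℕ)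
    (K : ∀ x : V, Finset (Fin (n x))) : ℤ :=
  (∑ x : V, ∑ j : Fin (K x).card,
      (((((K x).orderIsoOfFin rfl j : Fin (n x)) : ℕ) : ℤ) - ((j : ℕ) : ℤ))) -
  ∑ a : A, ((K (src a)).card : ℤ) * ((n (tgt a) : ℤ) - ((K (tgt a)).card : ℤ))

/-- Composition `K ∘ L` of a family of subsets with a family of subsets of the index sets. -/
def composeFam {V : Type} {n : V → ℕ} (K : ∀ x : V, Finset (Fin (n x)))
    (L : ∀ x : V, Finset (Fin (K x).card)) : ∀ x : V, Finset (Fin (n x)) :=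
  fun x => (L x).image (fun j => ((K x).orderIsoOfFin rfl j : Fin (n x)))

/-- The moment map for the action of `∏_x U(n_x)` on the representation space of the quiver,
`μ_x(r) = Σ_{b : y→x} r_b r_b^* − Σ_{a : x→y} r_a^* r_a`. -/
def momentMap {V A : Type} [Fintype A] [DecidableEq V] (src tgt : A → V) (n : V → ℕ)
    (r : ∀ a : A, Matrix (Fin (n (tgt a))) (Fin (n (src a))) ℂ) (x : V) :
    Matrix (Fin (n x)) (Fin (n x)) ℂ :=
  (∑ a : A, if h : tgt a = x then
      Matrix.reindex (finCongr (congrArg n h)) (finCongr (congrArg n h)) (r a * (r a)ᴴ)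
    else 0) -
  (∑ a : A, if h : src a = x then
      Matrix.reindex (finCongr (congrArg n h)) (finCongr (congrArg n h)) ((r a)ᴴ * r a)
    else 0)

/-! ### The quiver `Q_{3,3}` with vertices `1,…,6` and arrows `1→3, 2→3, 4→3, 4→5, 4→6`
(0-indexed: `0→2, 1→2, 3→2, 3→4, 3→5`). -/

def q33src : Fin 5 → Fin 6 := ![0, 1, 3, 3, 3]

def q33tgt : Fin 5 → Fin 6 := ![2, 2, 2, 4, 5]

/-- The dimension vector `[p,p,p,q,q,q]` for `Q_{3,3}`. -/
def n33 (p q : ℕ) : Fin 6 → ℕ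
  | ⟨0, _⟩ => p
  | ⟨1, _⟩ => p
  | ⟨2, _⟩ => p
  | ⟨3, _⟩ => q
  | ⟨4, _⟩ => q
  | ⟨5, _⟩ => q

/-- A family of subsets for `Q_{3,3}` built from three subsets of `{1,…,p}` (vertices 1,2,3)
and three subsets of `{1,…,q}` (vertices 4,5,6). -/
def fam6 (p q : ℕ) (K : Fin 3 → Finset (Fin p)) (L : Fin 3 → Finset (Fin q)) :
    ∀ x : Fin 6, Finset (Fin (n33 p q x))
  | ⟨0, _⟩ => K 0
  | ⟨1, _⟩ => K 1
  | ⟨2, _⟩ => K 2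
  | ⟨3, _⟩ => L 0
  | ⟨4, _⟩ => L 1
  | ⟨5, _⟩ => L 2

/-! ### The pseudo-unitary group `U(p,q)` -/

/-- The matrix `η = diag(I_p, −I_q)`. -/
def etaMat (p q : ℕ) : Matrix (Fin (p + q)) (Fin (p + q)) ℂ :=
  Matrix.diagonal fun i => if (i : ℕ) < p then 1 else -1

/-- Membership in `U(p,q) = {g : gᴴ η g = η}`. -/
def InUpq (p q : ℕ) (g : Matrix (Fin (p + q)) (Fin (p + q)) ℂ) : Prop :=
  gᴴ * etaMat p q * g = etaMat p q

/-- The central element `Z = diag(q I_p, −p I_q)`. -/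
def Zmat (p q : ℕ) : Matrix (Fin (p + q)) (Fin (p + q)) ℂ :=
  Matrix.diagonal fun i => if (i : ℕ) < p then (q : ℂ) else -(p : ℂ)

/-- The complex diagonal matrix with entries a real sequence. -/
def Dmat {n : ℕ} (A : Fin n → ℝ) : Matrix (Fin n) (Fin n) ℂ :=
  Matrix.diagonal fun i => (A i : ℂ)

/-- The block-diagonal matrix `u ⊕ v`. -/
def blockDiag {p q : ℕ} (u : Matrix (Fin p) (Fin p) ℂ) (v : Matrix (Fin q) (Fin q) ℂ) :
    Matrix (Fin (p + q)) (Fin (p + q)) ℂ :=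
  Matrix.reindex finSumFinEquiv finSumFinEquiv (Matrix.fromBlocks u 0 0 v)

end

/-- An increasing enough family of subspaces of `ℂ^n` contains an orthonormal system of
representatives. -/
lemma exists_orthonormal_of_finrank {n k : ℕ} (T : Fin k → Submodule ℂ (Fin n → ℂ))
    (hT : ∀ j : Fin k, (j : ℕ) + 1 ≤ Module.finrank ℂ (T j)) :
    ∃ v : Fin k → Fin n → ℂ, (∀ j, v j ∈ T j) ∧
      ∀ i j, star (v i) ⬝ᵥ v j = if i = j then 1 else 0 := by
  induction k with
  | zero => exact ⟨fun j => j.elim0, fun j => j.elim0, fun j => j.elim0⟩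
  | succ k ih =>
    obtain ⟨v, hv, ho⟩ := ih (fun j => T j.castSucc) (fun j => hT j.castSucc)
    let φ : T (Fin.last k) →ₗ[ℂ] (Fin k → ℂ) :=
      (Matrix.mulVecLin (Matrix.of fun i => star (v i))).comp (T (Fin.last k)).subtype
    have hlt : Module.finrank ℂ (Fin k → ℂ) < Module.finrank ℂ (T (Fin.last k)) := by
      have := hT (Fin.last k)
      simp at this ⊢
      omega
    obtain ⟨x, hx, hx0⟩ := (Submodule.ne_bot_iff _).1
      (LinearMap.ker_ne_bot_of_finrank_lt (f := φ) hlt)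
    have horth : ∀ i, star (v i) ⬝ᵥ (x : Fin n → ℂ) = 0 := fun i => congrFun hx i
    have horth' : ∀ i, star (x : Fin n → ℂ) ⬝ᵥ v i = 0 := fun i => by
      rw [star_dotProduct, horth, star_zero]
    have hxne : (x : Fin n → ℂ) ≠ 0 := fun h => hx0 (Subtype.ext h)
    set s : ℝ := ∑ i, ‖(x : Fin n → ℂ) i‖ ^ 2 with hs
    have hxx : star (x : Fin n → ℂ) ⬝ᵥ (x : Fin n → ℂ) = (s : ℂ) := by
      simp [dotProduct, hs, ← Complex.conj_mul']
    have hspos : 0 < s := by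
      obtain ⟨i, hi⟩ := Function.ne_iff.1 hxne
      exact Finset.sum_pos' (fun _ _ => by positivity)
        ⟨i, Finset.mem_univ _, by have := norm_pos_iff.2 hi; positivity⟩
    set c : ℂ := (((Real.sqrt s)⁻¹ : ℝ) : ℂ) with hc
    refine ⟨Fin.snoc v (c • (x : Fin n → ℂ)), ?_, ?_⟩
    · intro j
      refine Fin.lastCases ?_ (fun j => ?_) j
      · simpa using Submodule.smul_mem _ c x.2
      · simpa using hv j
    · intro i j
      refine Fin.lastCases ?_ (fun i => ?_) i <;> refine Fin.lastCases ?_ (fun j => ?_) j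
      · have : (Real.sqrt s)⁻¹ * ((Real.sqrt s)⁻¹ * s) = 1 := by
          rw [← mul_assoc, ← mul_inv, Real.mul_self_sqrt hspos.le, inv_mul_cancel₀ hspos.ne']
        simp only [Fin.snoc_last, star_smul, smul_dotProduct, dotProduct_smul, hxx, if_true, hc,
          smul_eq_mul, Complex.star_def, Complex.conj_ofReal]
        exact_mod_cast this
      · simp [star_smul, horth', Fin.ext_iff, j.isLt.ne']
      · simp [horth, Fin.ext_iff, i.isLt.ne]
      · simpa using ho i j

/-- An orthonormal frame indexed by `K`, adapted to the standard flag. -/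
def IsFrame {n : ℕ} (K : Finset (Fin n)) (W : Matrix (Fin n) (Fin n) ℂ) : Prop :=
  Wᴴ * W = diagonal (fun j => if j ∈ K then 1 else 0) ∧ ∀ i j, j < i → W i j = 0

open scoped ComplexOrder in
lemma IsFrame.mul_diagonal_eq {n : ℕ} {K : Finset (Fin n)} {W : Matrix (Fin n) (Fin n) ℂ}
    (h : IsFrame K W) : W * diagonal (fun j => if j ∈ K then (1 : ℂ) else 0) = W := by
  have : (W * diagonal (fun j => if j ∈ K then (1 : ℂ) else 0) - W)ᴴ *
      (W * diagonal (fun j => if j ∈ K then (1 : ℂ) else 0) - W) = 0 := by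
    have hd : (diagonal (fun j => if j ∈ K then (1 : ℂ) else 0))ᴴ =
        diagonal (fun j => if j ∈ K then (1 : ℂ) else 0) := by
      rw [diagonal_conjTranspose]; congr 1; ext j; by_cases hj : j ∈ K <;> simp [hj]
    rw [conjTranspose_sub, conjTranspose_mul, hd]
    simp only [sub_mul, mul_sub, Matrix.mul_assoc, h.1]
    simp only [← Matrix.mul_assoc, h.1]
    simp only [diagonal_mul_diagonal, diagonal_sub]
    rw [diagonal_eq_zero]
    ext i
    by_cases hi : i ∈ K <;> simp [hi]
  rw [Matrix.conjTranspose_mul_self_eq_zero, sub_eq_zero] at this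
  exact this

open scoped ComplexOrder in
lemma finrank_range_of_conjTranspose_mul_self {n : ℕ} {K : Finset (Fin n)}
    {W : Matrix (Fin n) (Fin n) ℂ}
    (h : Wᴴ * W = diagonal (fun j => if j ∈ K then 1 else 0)) :
    Module.finrank ℂ (LinearMap.range W.mulVecLin) = K.card := by
  change W.rank = _
  rw [← Matrix.rank_conjTranspose_mul_self, h, Matrix.rank_diagonal]
  simp

lemma card_filter_le_orderIsoOfFin {n : ℕ} (K : Finset (Fin n)) (j : Fin K.card) :
    (K.filter (fun i => i ≤ ((K.orderIsoOfFin rfl j : Fin n)))).card = j + 1 := by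
  have : K.filter (fun i => i ≤ ((K.orderIsoOfFin rfl j : Fin n))) =
      (Finset.Iic j).map ⟨fun i => (K.orderIsoOfFin rfl i : Fin n), fun a b hab =>
        (K.orderIsoOfFin rfl).injective (Subtype.ext hab)⟩ := by
    ext i
    simp only [Finset.mem_filter, Finset.mem_map, Finset.mem_Iic]
    constructor
    · rintro ⟨hi, hle⟩
      refine ⟨(K.orderIsoOfFin rfl).symm ⟨i, hi⟩, ?_,
        congrArg Subtype.val ((K.orderIsoOfFin rfl).apply_symm_apply ⟨i, hi⟩)⟩
      rw [OrderIso.symm_apply_le]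
      exact hle
    · rintro ⟨a, ha, rfl⟩
      exact ⟨(K.orderIsoOfFin rfl a).2, (K.orderIsoOfFin rfl).monotone ha⟩
  rw [this, Finset.card_map, Fin.card_Iic]

lemma finrank_range_mul_diagonal_le {n : ℕ} {W : Matrix (Fin n) (Fin n) ℂ}
    (hW : ∀ i j, j < i → W i j = 0) (m : Fin n) :
    Module.finrank ℂ (LinearMap.range
      (W * diagonal (fun i => if i ≤ m then (1 : ℂ) else 0)).mulVecLin) ≤
    Module.finrank ℂ ((LinearMap.range W.mulVecLin ⊓ stdFlag n ((m : ℕ) + 1) :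
        Submodule ℂ (Fin n → ℂ))) := by
  apply Submodule.finrank_mono
  rintro _ ⟨u, rfl⟩
  refine ⟨⟨diagonal (fun i => if i ≤ m then (1 : ℂ) else 0) *ᵥ u, by simp⟩, ?_⟩
  intro i hi
  simp only [mulVecLin_apply, mulVec, dotProduct]
  refine Finset.sum_eq_zero fun k _ => ?_
  rw [mul_diagonal]
  by_cases hk : k ≤ m
  · have : k < i := by
      have : (k : ℕ) ≤ m := hk
      exact Fin.lt_def.2 (by omega)
    simp [hW i k this]
  · simp [hk]

lemma IsFrame.schubert {n : ℕ} {K : Finset (Fin n)} {W : Matrix (Fin n) (Fin n) ℂ}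
    (h : IsFrame K W) (j : Fin K.card) :
    (j : ℕ) + 1 ≤ Module.finrank ℂ
      ((LinearMap.range W.mulVecLin ⊓ stdFlag n (((K.orderIsoOfFin rfl j : Fin n) : ℕ) + 1) :
        Submodule ℂ (Fin n → ℂ))) := by
  refine le_trans ?_ (finrank_range_mul_diagonal_le h.2 (K.orderIsoOfFin rfl j))
  set m : Fin n := (K.orderIsoOfFin rfl j : Fin n)
  set D : Matrix (Fin n) (Fin n) ℂ := diagonal (fun i => if i ≤ m then 1 else 0) with hD
  have hDs : Dᴴ = D := by
    rw [hD, diagonal_conjTranspose]; congr 1; ext j; by_cases hj : j ≤ m <;> simp [hj]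
  have hWD : (W * D)ᴴ * (W * D) =
      diagonal (fun i => if i ∈ K.filter (fun i => i ≤ m) then 1 else 0) := by
    rw [conjTranspose_mul, hDs, Matrix.mul_assoc, ← Matrix.mul_assoc Wᴴ, h.1, hD,
      diagonal_mul_diagonal, diagonal_mul_diagonal]
    congr 1; ext i; by_cases h1 : i ∈ K <;> by_cases h2 : i ≤ m <;> simp [h1, h2]
  rw [finrank_range_of_conjTranspose_mul_self hWD, card_filter_le_orderIsoOfFin]

lemma exists_frame_of_schubert {n : ℕ} {K : Finset (Fin n)} {S : Submodule ℂ (Fin n → ℂ)}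
    (hS : Module.finrank ℂ S = K.card)
    (h : ∀ j : Fin K.card, (j : ℕ) + 1 ≤ Module.finrank ℂ
      ((S ⊓ stdFlag n (((K.orderIsoOfFin rfl j : Fin n) : ℕ) + 1) :
        Submodule ℂ (Fin n → ℂ)))) :
    ∃ W, IsFrame K W ∧ LinearMap.range W.mulVecLin = S := by
  obtain ⟨v, hv, ho⟩ := exists_orthonormal_of_finrank _ h
  set e := K.orderIsoOfFin rfl
  set W : Matrix (Fin n) (Fin n) ℂ :=
    Matrix.of fun i j => if hj : j ∈ K then v (e.symm ⟨j, hj⟩) i else 0 with hW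
  have hcol : ∀ j (hj : j ∈ K), W.col j = v (e.symm ⟨j, hj⟩) := fun j hj => by
    ext i; simp [hW, hj]
  have hcol0 : ∀ j, j ∉ K → W.col j = 0 := fun j hj => by
    ext i; simp [hW, hj]
  have hf : IsFrame K W := by
    constructor
    · ext i j
      have : (Wᴴ * W) i j = star (W.col i) ⬝ᵥ W.col j := rfl
      rw [this, diagonal_apply]
      by_cases hi : i ∈ K
      · by_cases hj : j ∈ K
        · rw [hcol i hi, hcol j hj, ho]
          simp [hi]
        · rw [hcol0 j hj]
          by_cases hij : i = j
          · subst hij; contradiction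
          · simp [hij]
      · simp [hcol0 i hi, hi]
    · intro i j hij
      by_cases hj : j ∈ K
      · have := (hv (e.symm ⟨j, hj⟩)).2 i (by
          simp only [e, OrderIso.apply_symm_apply]; exact hij)
        simpa [hW, hj] using this
      · simp [hW, hj]
  refine ⟨W, hf, ?_⟩
  apply Submodule.eq_of_le_of_finrank_eq
  · rw [Matrix.range_mulVecLin, Submodule.span_le]
    rintro _ ⟨j, rfl⟩
    by_cases hj : j ∈ K
    · rw [hcol j hj]; exact (hv _).1
    · rw [hcol0 j hj]; exact S.zero_mem
  · rw [hS, finrank_range_of_conjTranspose_mul_self hf.1]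

lemma IsFrame.mulVec_of_mem_range {n : ℕ} {K : Finset (Fin n)} {W : Matrix (Fin n) (Fin n) ℂ}
    (h : IsFrame K W) {u : Fin n → ℂ} (hu : u ∈ LinearMap.range W.mulVecLin) :
    W *ᵥ (Wᴴ *ᵥ u) = u := by
  obtain ⟨c, rfl⟩ := hu
  simp only [mulVecLin_apply, mulVec_mulVec]
  rw [← Matrix.mul_assoc, Matrix.mul_assoc, h.1, h.mul_diagonal_eq]

lemma IsFrame.norm_le_one {n : ℕ} {K : Finset (Fin n)} {W : Matrix (Fin n) (Fin n) ℂ}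
    (h : IsFrame K W) (i j : Fin n) : ‖W i j‖ ≤ 1 := by
  have h1 : (Wᴴ * W) j j = ((∑ k, ‖W k j‖ ^ 2 : ℝ) : ℂ) := by
    simp [mul_apply, ← Complex.conj_mul']
  have h2 : ∑ k, ‖W k j‖ ^ 2 ≤ 1 := by
    rw [h.1, diagonal_apply_eq] at h1
    by_cases hj : j ∈ K
    · rw [if_pos hj] at h1
      exact le_of_eq (by exact_mod_cast h1.symm)
    · rw [if_neg hj] at h1
      have : ∑ k, ‖W k j‖ ^ 2 = 0 := by exact_mod_cast h1.symm
      rw [this]; exact zero_le_one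
  have h3 : ‖W i j‖ ^ 2 ≤ 1 :=
    (Finset.single_le_sum (f := fun k => ‖W k j‖ ^ 2) (fun _ _ => by positivity)
      (Finset.mem_univ i)).trans h2
  exact (sq_le_one_iff₀ (norm_nonneg _)).1 h3

lemma isCompact_norm_le_one {V : Type} (n : V → ℕ) :
    IsCompact {W : ∀ x : V, Matrix (Fin (n x)) (Fin (n x)) ℂ | ∀ x i j, ‖W x i j‖ ≤ 1} := by
  have : {W : ∀ x : V, Matrix (Fin (n x)) (Fin (n x)) ℂ | ∀ x i j, ‖W x i j‖ ≤ 1} =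
      Set.pi Set.univ (fun x => Set.pi Set.univ fun _ : Fin (n x) =>
        Set.pi Set.univ fun _ : Fin (n x) => Metric.closedBall (0 : ℂ) 1) := by
    ext W
    exact ⟨fun h x _ i _ j _ => mem_closedBall_zero_iff.2 (h x i j),
      fun h x i j => mem_closedBall_zero_iff.1 (h x trivial i trivial j trivial)⟩
  rw [this]
  exact isCompact_univ_pi fun x => isCompact_univ_pi fun _ => isCompact_univ_pi fun _ =>
    isCompact_closedBall _ _

/-- The matrices of a representation preserve the spans of an adapted family of frames. -/
def HasFrame {V A : Type} {src tgt : A → V} {n : V → ℕ}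
    (r : ∀ a : A, Matrix (Fin (n (tgt a))) (Fin (n (src a))) ℂ)
    (K : ∀ x : V, Finset (Fin (n x))) : Prop :=
  ∃ W : ∀ x : V, Matrix (Fin (n x)) (Fin (n x)) ℂ, (∀ x, IsFrame (K x) (W x)) ∧
    ∀ a, r a * W (src a) = W (tgt a) * ((W (tgt a))ᴴ * (r a * W (src a)))

/-- `r` has a subrepresentation in the Schubert variety of `K`. -/
def HasSchubertSubrep {V A : Type} {src tgt : A → V} {n : V → ℕ}
    (r : ∀ a : A, Matrix (Fin (n (tgt a))) (Fin (n (src a))) ℂ)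
    (K : ∀ x : V, Finset (Fin (n x))) : Prop :=
  ∃ S : ∀ x : V, Submodule ℂ (Fin (n x) → ℂ),
      (∀ x : V, Module.finrank ℂ (S x) = (K x).card) ∧
      (∀ x : V, ∀ j : Fin (K x).card,
        (j : ℕ) + 1 ≤ Module.finrank ℂ
          ((S x ⊓ stdFlag (n x) ((((K x).orderIsoOfFin rfl j : Fin (n x)) : ℕ) + 1) :
            Submodule ℂ (Fin (n x) → ℂ)))) ∧
      (∀ a : A, (S (src a)).map (r a).mulVecLin ≤ S (tgt a))

lemma hasFrame_iff_hasSchubertSubrep {V A : Type} {src tgt : A → V} {n : V → ℕ}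
    (r : ∀ a : A, Matrix (Fin (n (tgt a))) (Fin (n (src a))) ℂ)
    (K : ∀ x : V, Finset (Fin (n x))) : HasFrame r K ↔ HasSchubertSubrep r K := by
  constructor
  · rintro ⟨W, hW, hr⟩
    refine ⟨fun x => LinearMap.range (W x).mulVecLin,
      fun x => finrank_range_of_conjTranspose_mul_self (hW x).1, fun x => (hW x).schubert, ?_⟩
    rintro a _ ⟨_, ⟨u, rfl⟩, rfl⟩
    refine ⟨((W (tgt a))ᴴ * (r a * W (src a))) *ᵥ u, ?_⟩
    simp only [mulVecLin_apply, mulVec_mulVec]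
    rw [← hr a]
  · rintro ⟨S, h1, h2, h3⟩
    choose W hW hWS using fun x => exists_frame_of_schubert (h1 x) (h2 x)
    refine ⟨W, hW, fun a => ext_of_mulVec_single fun i => ?_⟩
    have : (r a * W (src a)) *ᵥ Pi.single i 1 ∈ LinearMap.range (W (tgt a)).mulVecLin := by
      rw [hWS]
      refine h3 a ⟨W (src a) *ᵥ Pi.single i 1, ?_, by rw [mulVecLin_apply, mulVec_mulVec]⟩
      rw [← hWS]
      exact ⟨_, rfl⟩
    rw [← mulVec_mulVec _ (W (tgt a)), ← mulVec_mulVec _ (W (tgt a))ᴴ, (hW _).mulVec_of_mem_range this]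

lemma isQIntersecting_iff {V A : Type} {src tgt : A → V} {n : V → ℕ}
    (K : ∀ x : V, Finset (Fin (n x))) :
    IsQIntersecting src tgt n K ↔
      ∀ r : ∀ a : A, Matrix (Fin (n (tgt a))) (Fin (n (src a))) ℂ, HasFrame r K := by
  simp only [hasFrame_iff_hasSchubertSubrep]
  constructor
  · intro h r
    exact h fun a => (r a).mulVecLin
  · intro h r
    have := h fun a => LinearMap.toMatrix' (r a)
    simpa only [HasSchubertSubrep, ← Matrix.toLin'_apply', Matrix.toLin'_toMatrix'] using this

lemma sum_trace_mul_momentMap {V A : Type} [Fintype V] [Fintype A] [DecidableEq V]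
    (src tgt : A → V) (n : V → ℕ)
    (r : ∀ a : A, Matrix (Fin (n (tgt a))) (Fin (n (src a))) ℂ)
    (X : ∀ x : V, Matrix (Fin (n x)) (Fin (n x)) ℂ) :
    ∑ x, (X x * momentMap src tgt n r x).trace =
      ∑ a, ((X (tgt a) * (r a * (r a)ᴴ)).trace - (X (src a) * ((r a)ᴴ * r a)).trace) := by
  simp only [momentMap, Matrix.mul_sub, Matrix.mul_sum, trace_sub, trace_sum,
    Finset.sum_sub_distrib]
  congr 1
  · rw [Finset.sum_comm]
    refine Finset.sum_congr rfl fun a _ => ?_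
    rw [Finset.sum_eq_single (tgt a)]
    · simp
    · intro x _ hx
      simp [hx.symm]
    · simp
  · rw [Finset.sum_comm]
    refine Finset.sum_congr rfl fun a _ => ?_
    rw [Finset.sum_eq_single (src a)]
    · simp
    · intro x _ hx
      simp [hx.symm]
    · simp

open scoped ComplexOrder in
lemma trace_frame_nonneg {m n : ℕ} {K : Finset (Fin m)} {L : Finset (Fin n)}
    {W : Matrix (Fin m) (Fin m) ℂ} {U : Matrix (Fin n) (Fin n) ℂ} (hW : IsFrame K W)
    (hU : IsFrame L U) {r : Matrix (Fin n) (Fin m) ℂ} (h : r * W = U * (Uᴴ * (r * W))) :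
    0 ≤ ((U * Uᴴ * (r * rᴴ)).trace - (W * Wᴴ * (rᴴ * r)).trace).re := by
  have hPs : ∀ {k : ℕ} {M : Finset (Fin k)} {T : Matrix (Fin k) (Fin k) ℂ}, IsFrame M T →
      (T * Tᴴ) * (T * Tᴴ) = T * Tᴴ := fun hT => by
    rw [Matrix.mul_assoc, ← Matrix.mul_assoc _ _ (_ᴴ), hT.1, ← Matrix.mul_assoc,
      hT.mul_diagonal_eq]
  have hP := hPs hU
  have hQ := hPs hW
  have hPh : (U * Uᴴ)ᴴ = U * Uᴴ := by simp
  have hQh : (W * Wᴴ)ᴴ = W * Wᴴ := by simp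
  have hr : (U * Uᴴ) * (r * (W * Wᴴ)) = r * (W * Wᴴ) := by
    conv_rhs => rw [← Matrix.mul_assoc, h]
    simp only [Matrix.mul_assoc]
  set P := U * Uᴴ
  set Q := W * Wᴴ
  have hr' : Q * rᴴ * P = Q * rᴴ := by
    have := congrArg conjTranspose hr
    rwa [conjTranspose_mul, conjTranspose_mul, hPh, hQh] at this
  have key : (P * (r * rᴴ)).trace - (Q * (rᴴ * r)).trace =
      ((P * r - r * Q) * (P * r - r * Q)ᴴ).trace := by
    have e1 : (P * r * (rᴴ * P)).trace = (P * (r * rᴴ)).trace := by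
      rw [← Matrix.mul_assoc, trace_mul_comm, ← Matrix.mul_assoc, ← Matrix.mul_assoc, hP,
        Matrix.mul_assoc]
    have e2 : (P * r * (Q * rᴴ)).trace = (Q * (rᴴ * r)).trace := by
      rw [trace_mul_comm, ← Matrix.mul_assoc, hr', Matrix.mul_assoc]
    have e3 : (r * Q * (rᴴ * P)).trace = (Q * (rᴴ * r)).trace := by
      rw [Matrix.mul_assoc, ← Matrix.mul_assoc Q, hr', trace_mul_comm, Matrix.mul_assoc]
    have e4 : (r * Q * (Q * rᴴ)).trace = (Q * (rᴴ * r)).trace := by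
      rw [Matrix.mul_assoc, ← Matrix.mul_assoc Q, hQ, trace_mul_comm, Matrix.mul_assoc]
    rw [conjTranspose_sub, conjTranspose_mul P, conjTranspose_mul r, hPh, hQh]
    simp only [Matrix.sub_mul, Matrix.mul_sub, trace_sub, e1, e2, e3, e4]
    ring
  rw [key]
  exact (Complex.le_def.1 (posSemidef_self_mul_conjTranspose (P * r - r * Q)).trace_nonneg).1

lemma IsFrame.sum_le_trace {n : ℕ} {K : Finset (Fin n)} {W : Matrix (Fin n) (Fin n) ℂ}
    (h : IsFrame K W) {l : Fin n → ℤ} (hl : Antitone l) :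
    ((∑ j ∈ K, l j : ℤ) : ℝ) ≤ (W * Wᴴ * diagonal (fun j => (l j : ℂ))).trace.re := by
  have h1 : (W * Wᴴ * diagonal (fun j => (l j : ℂ))).trace =
      ((∑ j, ∑ i, (l i : ℝ) * ‖W i j‖ ^ 2 : ℝ) : ℂ) := by
    rw [Finset.sum_comm]
    simp only [Matrix.trace, diag_apply, Matrix.mul_diagonal]
    push_cast
    refine Finset.sum_congr rfl fun i _ => ?_
    rw [mul_apply, Finset.sum_mul]
    refine Finset.sum_congr rfl fun j _ => ?_
    rw [conjTranspose_apply, Complex.star_def, Complex.mul_conj', mul_comm]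
  have h2 : ∀ j, ∑ k, ‖W k j‖ ^ 2 = if j ∈ K then (1 : ℝ) else 0 := fun j => by
    have h1 : (Wᴴ * W) j j = ((∑ k, ‖W k j‖ ^ 2 : ℝ) : ℂ) := by
      simp [mul_apply, ← Complex.conj_mul']
    rw [h.1, diagonal_apply_eq] at h1
    split_ifs at h1 ⊢ <;> exact_mod_cast h1.symm
  rw [h1, Complex.ofReal_re]
  calc ((∑ j ∈ K, l j : ℤ) : ℝ) = ∑ j, (l j : ℝ) * ∑ k, ‖W k j‖ ^ 2 := by
        push_cast
        simp [h2]
    _ ≤ _ := by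
        refine Finset.sum_le_sum fun j _ => ?_
        rw [Finset.mul_sum]
        refine Finset.sum_le_sum fun i _ => ?_
        rcases lt_or_ge j i with hij | hij
        · simp [h.2 i j hij]
        · have : (l j : ℝ) ≤ l i := by exact_mod_cast hl hij
          gcongr

lemma horn_of_momentMap_eq {V A : Type} [Fintype V] [Fintype A] [DecidableEq V] {src tgt : A → V}
    {n : V → ℕ} {lam : ∀ x : V, Fin (n x) → ℤ} (hlam : ∀ x : V, Antitone (lam x))
    {r : ∀ a : A, Matrix (Fin (n (tgt a))) (Fin (n (src a))) ℂ}
    (hr : ∀ x : V, momentMap src tgt n r x =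
      -(Matrix.diagonal fun j : Fin (n x) => ((lam x j : ℤ) : ℂ))) :
    (∑ x : V, ∑ j : Fin (n x), lam x j) = 0 ∧
       (∀ K : ∀ x : V, Finset (Fin (n x)), IsQIntersecting src tgt n K →
          (∑ x : V, ∑ j ∈ K x, lam x j) ≤ 0) := by
  constructor
  · have := sum_trace_mul_momentMap src tgt n r (fun _ => 1)
    simp only [hr, Matrix.one_mul, trace_neg, trace_diagonal] at this
    rw [Finset.sum_neg_distrib, Finset.sum_eq_zero fun (a : A) _ => by
      rw [trace_mul_comm (r a), sub_self], neg_eq_zero] at this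
    exact_mod_cast this
  · intro K hK
    obtain ⟨W, hW, hWr⟩ := (isQIntersecting_iff K).1 hK r
    have h1 := sum_trace_mul_momentMap src tgt n r (fun x => W x * (W x)ᴴ)
    simp only [hr, Matrix.mul_neg, trace_neg, Finset.sum_neg_distrib] at h1
    have h2 := congrArg Complex.re h1
    rw [Complex.neg_re, Complex.re_sum, Complex.re_sum] at h2
    have h3 := Finset.sum_nonneg fun a (_ : a ∈ Finset.univ) =>
      trace_frame_nonneg (hW (src a)) (hW (tgt a)) (hWr a)
    have h4 := Finset.sum_le_sum fun x (_ : x ∈ Finset.univ) => (hW x).sum_le_trace (hlam x)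
    have h5 : ((∑ x : V, ∑ j ∈ K x, lam x j : ℤ) : ℝ) ≤ 0 := by
      rw [Int.cast_sum]
      linarith
    exact_mod_cast h5

/-- The columns of `W` indexed by `K` represent a point of the Schubert cell of `K`. -/
def IsCell {n : ℕ} (K : Finset (Fin n)) (W : Matrix (Fin n) (Fin n) ℂ) : Prop :=
  (∀ i j, j < i → W i j = 0) ∧ (∀ j ∈ K, W j j = 1) ∧ ∀ i, ∀ j ∉ K, W i j = 0

/-- `r` has a subrepresentation in the Schubert cell of `K`. -/
def HasCell {V A : Type} {src tgt : A → V} {n : V → ℕ}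
    (r : ∀ a : A, Matrix (Fin (n (tgt a))) (Fin (n (src a))) ℂ)
    (K : ∀ x : V, Finset (Fin (n x))) : Prop :=
  ∃ (W : ∀ x : V, Matrix (Fin (n x)) (Fin (n x)) ℂ)
    (M : ∀ a : A, Matrix (Fin (n (tgt a))) (Fin (n (src a))) ℂ),
    (∀ x, IsCell (K x) (W x)) ∧ ∀ a, r a * W (src a) = W (tgt a) * M a

lemma IsCell.finrank_range {n : ℕ} {K : Finset (Fin n)} {W : Matrix (Fin n) (Fin n) ℂ}
    (h : IsCell K W) : Module.finrank ℂ (LinearMap.range W.mulVecLin) = K.card := by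
  change W.rank = _
  set U := W + diagonal (fun j => if j ∈ K then 0 else 1) with hU
  have hdet : U.det = 1 := by
    rw [det_of_isUpperTriangular]
    · refine Finset.prod_eq_one fun j _ => ?_
      by_cases hj : j ∈ K
      · simp [hU, hj, h.2.1 j hj]
      · simp [hU, hj, h.2.2 j j hj]
    · intro i j hij
      have : j < i := hij
      simp [hU, h.1 i j this, this.ne']
  have hW : W = U * diagonal (fun j => if j ∈ K then (1 : ℂ) else 0) := by
    ext i j
    rw [mul_diagonal]
    by_cases hj : j ∈ K
    · by_cases hij : i = j
      · subst hij; simp [hU, hj]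
      · simp [hU, hj, hij]
    · simp [h.2.2 i j hj, hj]
  rw [hW, rank_mul_eq_right_of_isUnit_det _ _ (by rw [hdet]; exact isUnit_one), rank_diagonal]
  simp

lemma IsCell.schubert {n : ℕ} {K : Finset (Fin n)} {W : Matrix (Fin n) (Fin n) ℂ}
    (h : IsCell K W) (j : Fin K.card) :
    (j : ℕ) + 1 ≤ Module.finrank ℂ
      ((LinearMap.range W.mulVecLin ⊓ stdFlag n (((K.orderIsoOfFin rfl j : Fin n) : ℕ) + 1) :
        Submodule ℂ (Fin n → ℂ))) := by
  refine le_trans ?_ (finrank_range_mul_diagonal_le h.1 (K.orderIsoOfFin rfl j))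
  have : IsCell (K.filter (fun i => i ≤ (K.orderIsoOfFin rfl j : Fin n)))
      (W * diagonal (fun i => if i ≤ (K.orderIsoOfFin rfl j : Fin n) then (1 : ℂ) else 0)) := by
    refine ⟨fun i k hik => ?_, fun k hk => ?_, fun i k hk => ?_⟩ <;> rw [mul_diagonal]
    · rw [h.1 i k hik, zero_mul]
    · rw [Finset.mem_filter] at hk
      rw [h.2.1 k hk.1, if_pos hk.2, one_mul]
    · by_cases hkK : k ∈ K
      · rw [if_neg, mul_zero]
        exact fun hle => hk (Finset.mem_filter.2 ⟨hkK, hle⟩)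
      · rw [h.2.2 i k hkK, zero_mul]
  rw [this.finrank_range, card_filter_le_orderIsoOfFin]

lemma HasCell.hasFrame {V A : Type} {src tgt : A → V} {n : V → ℕ}
    {r : ∀ a : A, Matrix (Fin (n (tgt a))) (Fin (n (src a))) ℂ}
    {K : ∀ x : V, Finset (Fin (n x))} (h : HasCell r K) : HasFrame r K := by
  obtain ⟨W, M, hW, hr⟩ := h
  rw [hasFrame_iff_hasSchubertSubrep]
  refine ⟨fun x => LinearMap.range (W x).mulVecLin, fun x => (hW x).finrank_range,
    fun x => (hW x).schubert, ?_⟩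
  rintro a _ ⟨_, ⟨u, rfl⟩, rfl⟩
  refine ⟨M a *ᵥ u, ?_⟩
  simp only [mulVecLin_apply, mulVec_mulVec]
  rw [← hr a]

/-- The index set of the coordinates of a representation. -/
abbrev RepIdx {V A : Type} (src tgt : A → V) (n : V → ℕ) : Type :=
  Σ a : A, Fin (n (tgt a)) × Fin (n (src a))

/-- The representation with given coordinates. -/
def repMat {V A : Type} {src tgt : A → V} {n : V → ℕ} {R : Type} (x : RepIdx src tgt n → R)
    (a : A) : Matrix (Fin (n (tgt a))) (Fin (n (src a))) R :=
  Matrix.of fun i j => x ⟨a, (i, j)⟩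

lemma continuous_repMat {V A : Type} {src tgt : A → V} {n : V → ℕ} (a : A) :
    Continuous fun x : RepIdx src tgt n → ℂ => repMat x a :=
  continuous_matrix fun i j => continuous_apply (⟨a, (i, j)⟩ : RepIdx src tgt n)

lemma isClosed_hasFrame {V A : Type} {src tgt : A → V} {n : V → ℕ}
    (K : ∀ x : V, Finset (Fin (n x))) :
    IsClosed {x : RepIdx src tgt n → ℂ | HasFrame (repMat x) K} := by
  set F : Set (∀ x : V, Matrix (Fin (n x)) (Fin (n x)) ℂ) := {W | ∀ x, IsFrame (K x) (W x)}
    with hF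
  have hFc : IsCompact F := by
    refine (isCompact_norm_le_one n).of_isClosed_subset ?_ fun W hW x i j => (hW x).norm_le_one i j
    simp only [hF, IsFrame, Set.ofPred_forall, Set.ofPred_and]
    refine isClosed_iInter fun x => IsClosed.inter ?_ ?_
    · exact isClosed_eq (by fun_prop) continuous_const
    · refine isClosed_iInter fun i => isClosed_iInter fun j => isClosed_iInter fun _ => ?_
      exact isClosed_eq (by fun_prop) continuous_const
  have : CompactSpace F := isCompact_iff_compactSpace.1 hFc
  have hC : IsClosed {p : F × (RepIdx src tgt n → ℂ) | ∀ a, repMat p.2 a * p.1.1 (src a) =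
      p.1.1 (tgt a) * ((p.1.1 (tgt a))ᴴ * (repMat p.2 a * p.1.1 (src a)))} := by
    simp only [Set.ofPred_forall]
    refine isClosed_iInter fun a => ?_
    have h1 : Continuous fun p : F × (RepIdx src tgt n → ℂ) => repMat p.2 a :=
      (continuous_repMat a).comp continuous_snd
    have h2 : ∀ x, Continuous fun p : F × (RepIdx src tgt n → ℂ) => p.1.1 x := fun x =>
      (continuous_apply x).comp (continuous_subtype_val.comp continuous_fst)
    have h3 := h1.matrix_mul (h2 (src a))
    exact isClosed_eq h3 ((h2 _).matrix_mul ((h2 _).matrix_conjTranspose.matrix_mul h3))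
  convert isClosedMap_snd_of_compactSpace _ hC using 1
  ext x
  constructor
  · rintro ⟨W, hW, h⟩
    exact ⟨(⟨W, hW⟩, x), h, rfl⟩
  · rintro ⟨⟨⟨W, hW⟩, _⟩, h, rfl⟩
    exact ⟨W, hW, h⟩

lemma HasCell.map {V A : Type} {src tgt : A → V} {n : V → ℕ}
    {x : RepIdx src tgt n → ℂ} {K : ∀ x : V, Finset (Fin (n x))} (h : HasCell (repMat x) K)
    (σ : ℂ →+* ℂ) : HasCell (repMat fun i => σ (x i)) K := by
  obtain ⟨W, M, hW, hr⟩ := h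
  refine ⟨fun v => (W v).map σ, fun a => (M a).map σ, fun v => ⟨fun i j hij => ?_, fun j hj => ?_,
    fun i j hj => ?_⟩, fun a => ?_⟩
  · simp [(hW v).1 i j hij]
  · simp [(hW v).2.1 j hj]
  · simp [(hW v).2.2 i j hj]
  · have h1 : (repMat fun i => σ (x i)) a = (repMat x a).map σ := rfl
    rw [h1, ← Matrix.map_mul, hr a, Matrix.map_mul]

lemma exists_ringEquiv_of_isTranscendenceBasis {ι κ : Type} {v : ι → ℂ} {w : κ → ℂ}
    (hv : IsTranscendenceBasis ℚ v) (hw : IsTranscendenceBasis ℚ w) (e : ι ≃ κ) :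
    ∃ σ : ℂ ≃+* ℂ, ∀ i, σ (v i) = w (e i) := by
  let := IsAlgClosed.isAlgClosure_of_transcendence_basis v hv
  let := IsAlgClosed.isAlgClosure_of_transcendence_basis w hw
  let f : Algebra.adjoin ℚ (Set.range v) ≃+* Algebra.adjoin ℚ (Set.range w) :=
    (hv.1.aevalEquiv.symm.trans (MvPolynomial.renameEquiv ℚ e)).trans hw.1.aevalEquiv
  refine ⟨IsAlgClosure.equivOfEquiv ℂ ℂ f, fun i => ?_⟩
  have h1 := IsAlgClosure.equivOfEquiv_algebraMap ℂ ℂ f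
    (⟨v i, Algebra.subset_adjoin ⟨i, rfl⟩⟩)
  have h2 : hv.1.aevalEquiv.symm ⟨v i, Algebra.subset_adjoin ⟨i, rfl⟩⟩ = MvPolynomial.X i := by
    rw [AlgEquiv.symm_apply_eq]
    ext
    simp
  have h3 : f ⟨v i, Algebra.subset_adjoin ⟨i, rfl⟩⟩ = ⟨w (e i), Algebra.subset_adjoin ⟨e i, rfl⟩⟩ := by
    change hw.1.aevalEquiv ((MvPolynomial.renameEquiv ℚ e) (hv.1.aevalEquiv.symm _)) = _
    rw [h2]
    ext
    simp
  rw [h3] at h1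
  exact h1

lemma exists_ringEquiv_of_algebraicIndependent {ι : Type} [Finite ι] {x y : ι → ℂ}
    (hx : AlgebraicIndependent ℚ x) (hy : AlgebraicIndependent ℚ y) :
    ∃ σ : ℂ ≃+* ℂ, ∀ i, σ (x i) = y i := by
  obtain ⟨S, hxS, hS⟩ := exists_isTranscendenceBasis_superset hx.to_subtype_range
  obtain ⟨T, hyT, hT⟩ := exists_isTranscendenceBasis_superset hy.to_subtype_range
  have hc : Cardinal.aleph0 < Cardinal.mk ℂ := by
    rw [Cardinal.mk_complex]; exact Cardinal.aleph0_lt_continuum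
  have hQ : Cardinal.mk ℚ ≤ Cardinal.aleph0 := by simp
  have cS := IsAlgClosed.cardinal_eq_cardinal_transcendence_basis_of_aleph0_lt _ hS hQ hc
  have cT := IsAlgClosed.cardinal_eq_cardinal_transcendence_basis_of_aleph0_lt _ hT hQ hc
  rw [Cardinal.lift_id, Cardinal.lift_id] at cS cT
  let xS : ι → S := fun i => ⟨x i, hxS ⟨i, rfl⟩⟩
  let yT : ι → T := fun i => ⟨y i, hyT ⟨i, rfl⟩⟩
  have hxi : Function.Injective xS := fun i j h => hx.injective (congrArg Subtype.val h)
  have hyi : Function.Injective yT := fun i j h => hy.injective (congrArg Subtype.val h)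
  let f : Set.range xS ↪ T :=
    ⟨fun z => yT ((Equiv.ofInjective xS hxi).symm z),
      hyi.comp (Equiv.injective _)⟩
  obtain ⟨g, hg⟩ := Cardinal.extend_function_of_lt f (by
    rw [← cS]
    exact lt_of_le_of_lt (Cardinal.mk_le_aleph0_iff.2 inferInstance) hc) (by
    rw [← Cardinal.eq, ← cS, ← cT])
  obtain ⟨σ, hσ⟩ := exists_ringEquiv_of_isTranscendenceBasis hS hT g
  refine ⟨σ, fun i => ?_⟩
  have h1 := hσ (xS i)
  have h2 := hg ⟨xS i, i, rfl⟩
  change g (xS i) = yT _ at h2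
  rw [h2, Equiv.ofInjective_symm_apply] at h1
  exact h1

lemma dense_algebraicIndependent (ι : Type) [Finite ι] :
    Dense {x : ι → ℂ | AlgebraicIndependent ℚ x} := by
  have := Fintype.ofFinite ι
  have e : {x : ι → ℂ | AlgebraicIndependent ℚ x} =
      ⋂ p : {p : MvPolynomial ι ℚ // p ≠ 0}, {x : ι → ℂ | MvPolynomial.aeval x p.1 ≠ 0} := by
    ext x
    simp only [Set.mem_ofPred_eq, algebraicIndependent_iff, Set.mem_iInter, Subtype.forall]
    exact forall_congr' fun p => not_imp_not.symm
  rw [e]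
  have hcont : ∀ p : MvPolynomial ι ℚ, Continuous fun x : ι → ℂ => MvPolynomial.aeval x p := by
    intro p
    simp only [MvPolynomial.aeval_def, MvPolynomial.eval₂_eq']
    fun_prop
  have : Countable (MvPolynomial ι ℚ) := by
    rw [← Cardinal.mk_le_aleph0_iff]
    refine MvPolynomial.cardinalMk_le_max.trans ?_
    simp
  refine dense_iInter_of_isOpen (fun p => isOpen_ne_fun (hcont p.1) continuous_const) ?_
  rintro ⟨p, hp⟩
  rw [dense_iff_inter_open]
  rintro U hU ⟨z, hz⟩
  by_contra hne
  apply hp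
  obtain ⟨ε, hε, hball⟩ := Metric.isOpen_iff.1 hU z hz
  have hinj : Function.Injective (MvPolynomial.map (σ := ι) (algebraMap ℚ ℂ)) :=
    MvPolynomial.map_injective _ (algebraMap ℚ ℂ).injective
  apply hinj
  rw [map_zero]
  refine MvPolynomial.funext_set (fun i => Metric.ball (z i) ε) (fun i => ?_) fun x hx => ?_
  · exact infinite_of_mem_nhds (z i) (Metric.ball_mem_nhds _ hε)
  · rw [map_zero, MvPolynomial.eval_map]
    by_contra h0
    refine hne ⟨x, hball ?_, h0⟩
    rw [ball_pi _ hε]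
    exact hx

lemma HasCell.isQIntersecting {V A : Type} [Finite A] {src tgt : A → V} {n : V → ℕ}
    {x : RepIdx src tgt n → ℂ} (hx : AlgebraicIndependent ℚ x) {K : ∀ x : V, Finset (Fin (n x))}
    (h : HasCell (repMat x) K) : IsQIntersecting src tgt n K := by
  rw [isQIntersecting_iff]
  have h1 : ∀ y : RepIdx src tgt n → ℂ, HasFrame (repMat y) K := by
    have hd := (dense_algebraicIndependent (RepIdx src tgt n)).mono (s₂ :=
        {y : RepIdx src tgt n → ℂ | HasFrame (repMat y) K}) fun y hy => by
      obtain ⟨σ, hσ⟩ := exists_ringEquiv_of_algebraicIndependent hx hy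
      have := h.map σ.toRingHom
      have e : (fun i => σ.toRingHom (x i)) = y := funext hσ
      rw [e] at this
      exact this.hasFrame
    exact fun y => (isClosed_hasFrame K).closure_subset (hd y)
  intro r
  exact h1 fun p => r p.1 p.2.1 p.2.2

/-- `w` records the positions of the leading nonzero entries of the columns of `T`. -/
def IsLeading {n : ℕ} {κ : Type} (T : Matrix (Fin n) κ ℂ) (w : κ → Fin n) : Prop :=
  Function.Injective w ∧ (∀ j k, k < w j → T k j = 0) ∧ ∀ j, T (w j) j ≠ 0

lemma exists_leading_index {n : ℕ} {v : Fin n → ℂ} (hv : v ≠ 0) :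
    ∃ p, (∀ k < p, v k = 0) ∧ v p ≠ 0 := by
  obtain ⟨i, hi⟩ := Function.ne_iff.1 hv
  obtain ⟨p, hp, hmin⟩ := WellFounded.has_min (wellFounded_lt (α := Fin n)) {p | v p ≠ 0} ⟨i, hi⟩
  exact ⟨p, fun k hk => by_contra fun h => hmin k h hk, hp⟩

lemma exists_isLeading {n : ℕ} (V : Matrix (Fin n) (Fin n) ℂ) (hV : V.det ≠ 0) :
    ∃ (R : Matrix (Fin n) (Fin n) ℂ) (w : Fin n → Fin n),
      (∀ i j, j < i → R i j = 0) ∧ (∀ j, R j j = 1) ∧ IsLeading (V * R) w := by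
  have hinj : ∀ u : Fin n → ℂ, u ≠ 0 → V *ᵥ u ≠ 0 := fun u hu h =>
    hV (exists_mulVec_eq_zero_iff.1 ⟨u, hu, h⟩)
  have key : ∀ j : Fin n, ∃ (u : Fin n → ℂ) (p : Fin n), (∀ i, j < i → u i = 0) ∧ u j = 1 ∧
      (∀ k < p, (V *ᵥ u) k = 0) ∧ (V *ᵥ u) p ≠ 0 ∧
      ∀ u' : Fin n → ℂ, (∀ i, j < i → u' i = 0) → u' j = 1 → ∃ k ≤ p, (V *ᵥ u') k ≠ 0 := by
    intro j
    have hlead : ∀ u : Fin n → ℂ, u j = 1 → ∃ p, (∀ k < p, (V *ᵥ u) k = 0) ∧ (V *ᵥ u) p ≠ 0 :=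
      fun u hu => exists_leading_index (hinj u fun h => by simp [h] at hu)
    let S : Set (Fin n) := {p | ∃ u : Fin n → ℂ, (∀ i, j < i → u i = 0) ∧ u j = 1 ∧
      (∀ k < p, (V *ᵥ u) k = 0) ∧ (V *ᵥ u) p ≠ 0}
    have hS : S.Nonempty := by
      obtain ⟨p, hp⟩ := hlead (Pi.single j 1) (by simp)
      exact ⟨p, Pi.single j 1, fun i hi => Pi.single_eq_of_ne hi.ne' _, by simp, hp⟩
    obtain ⟨p, ⟨u, hu⟩, hmax⟩ := Set.exists_max_image S id S.toFinite hS
    refine ⟨u, p, hu.1, hu.2.1, hu.2.2.1, hu.2.2.2, fun u' h1 h2 => ?_⟩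
    obtain ⟨q, hq⟩ := hlead u' h2
    exact ⟨q, hmax q ⟨u', h1, h2, hq⟩, hq.2⟩
  choose u w h1 h2 h3 h4 h5 using key
  have hcol : ∀ k j, (V * Matrix.of fun i j => u j i) k j = (V *ᵥ u j) k := fun k j => rfl
  refine ⟨Matrix.of fun i j => u j i, w, fun i j => h1 j i, h2, ?_, fun j k hk => ?_, fun j => ?_⟩
  · have hlt : ∀ j j', j < j' → w j ≠ w j' := by
      intro j j' hjj hw
      set c := (V *ᵥ u j') (w j) / (V *ᵥ u j) (w j)
      obtain ⟨k, hk, hne⟩ := h5 j' (u j' - c • u j) (fun i hi => by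
        simp [h1 j' i hi, h1 j i (hjj.trans hi)]) (by simp [h2, h1 j j' hjj])
      apply hne
      rw [mulVec_sub, mulVec_smul]
      simp only [Pi.sub_apply, Pi.smul_apply, smul_eq_mul]
      rcases hk.lt_or_eq with hk | rfl
      · rw [h3 j' k hk, h3 j k (hw ▸ hk)]; simp
      · rw [← hw, div_mul_cancel₀ _ (h4 j), sub_self]
    intro j j' hw
    rcases lt_trichotomy j j' with h | h | h
    · exact (hlt _ _ h hw).elim
    · exact h
    · exact (hlt _ _ h hw.symm).elim
  · rw [hcol]; exact h3 j k hk
  · rw [hcol]; exact h4 j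

lemma IsLeading.eq_zero_of_mulVec {n : ℕ} {κ : Type} [Fintype κ] {T : Matrix (Fin n) κ ℂ}
    {w : κ → Fin n} (h : IsLeading T w) {P : Fin n → Prop} (hP : ∀ i k, i ≤ k → P k → P i)
    {d : κ → ℂ} (hd : ∀ b, P (w b) → (T *ᵥ d) (w b) = 0) (b : κ) (hb : P (w b)) : d b = 0 := by
  induction hk : w b using WellFoundedLT.induction generalizing b with
  | ind k ih =>
    subst hk
    have h0 := hd b hb
    rw [mulVec, dotProduct, Finset.sum_eq_single b] at h0
    · exact (mul_eq_zero.1 h0).resolve_left (h.2.2 b)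
    · intro c _ hcb
      rcases lt_or_gt_of_ne (fun hw => hcb (h.1 hw) : w c ≠ w b) with hlt | hgt
      · rw [ih (w c) hlt c (hP _ _ hlt.le hb) rfl, mul_zero]
      · rw [h.2.1 c _ hgt, zero_mul]
    · simp

lemma IsLeading.det_ne_zero {n : ℕ} {κ : Type} [Fintype κ] [DecidableEq κ]
    {T : Matrix (Fin n) κ ℂ} {w : κ → Fin n} (h : IsLeading T w) :
    (T.submatrix w id).det ≠ 0 := by
  intro h0
  obtain ⟨d, hd, hd0⟩ := exists_mulVec_eq_zero_iff.2 h0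
  refine hd (funext fun b => h.eq_zero_of_mulVec (P := fun _ => True) (fun _ _ _ _ => trivial)
    (fun b _ => ?_) b trivial)
  exact congrFun hd0 b

lemma submatrix_mul_upper {n : ℕ} (V : Matrix (Fin n) (Fin n) ℂ) {R : Matrix (Fin n) (Fin n) ℂ}
    (hR : ∀ i j, j < i → R i j = 0) (w : Fin n → Fin n) (m : ℕ) :
    (V * R).submatrix (fun j : {j : Fin n // (j : ℕ) < m} => w j) Subtype.val =
      V.submatrix (fun j : {j : Fin n // (j : ℕ) < m} => w j)
          (Subtype.val : {j : Fin n // (j : ℕ) < m} → Fin n) *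
        R.submatrix Subtype.val Subtype.val := by
  ext a b
  simp only [submatrix_apply, mul_apply]
  refine ((Finset.sum_filter_of_ne (p := fun j : Fin n => (j : ℕ) < m) fun k _ hk => ?_).symm.trans
    (Finset.sum_subtype _ (by simp) _))
  by_contra hkm
  exact hk (by rw [hR k b (Fin.lt_def.2 (b.2.trans_le (not_lt.1 hkm))), mul_zero])

/-- The initial minors of a matrix, with rows permuted by the positions of leading entries,
do not vanish. -/
lemma IsLeading.minor_ne_zero {n : ℕ} {V R : Matrix (Fin n) (Fin n) ℂ} {w : Fin n → Fin n}
    (hR : ∀ i j, j < i → R i j = 0) (h : IsLeading (V * R) w) (m : ℕ) :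
    (V.submatrix (fun j : {j : Fin n // (j : ℕ) < m} => w j) Subtype.val).det ≠ 0 := by
  have h1 : IsLeading ((V * R).submatrix id (Subtype.val : {j : Fin n // (j : ℕ) < m} → Fin n))
      (fun j => w j) :=
    ⟨h.1.comp Subtype.val_injective, fun j k hk => h.2.1 j k hk, fun j => h.2.2 j⟩
  have h2 := h1.det_ne_zero
  have h3 := submatrix_mul_upper V hR w m
  rw [submatrix_submatrix] at h2
  change ((V * R).submatrix (fun j : {j : Fin n // (j : ℕ) < m} => w j) Subtype.val).det ≠ 0 at h2
  rw [h3, det_mul] at h2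
  exact left_ne_zero_of_mul h2

lemma hasCell_of_feasible {V A : Type} {src tgt : A → V} {n : V → ℕ}
    {r : ∀ a : A, Matrix (Fin (n (tgt a))) (Fin (n (src a))) ℂ}
    {U R : ∀ x, Matrix (Fin (n x)) (Fin (n x)) ℂ} {w : ∀ x, Fin (n x) → Fin (n x)}
    (hR : ∀ x, (∀ i j, j < i → R x i j = 0) ∧ ∀ j, R x j j = 1)
    (hw : ∀ x, IsLeading (U x * R x) (w x))
    {ρ : ∀ a : A, Matrix (Fin (n (tgt a))) (Fin (n (src a))) ℂ}
    (hρ : ∀ a, U (tgt a) * r a = ρ a * U (src a))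
    {D : ∀ x, Fin (n x) → ℝ} (hD : ∀ x, Antitone (D x))
    (hfeas : ∀ a i j, ρ a i j ≠ 0 → D (tgt a) i ≤ D (src a) j) (c : ℝ) :
    HasCell r fun x => Finset.univ.filter fun j => D x (w x j) ≤ c := by
  have hdet : ∀ x, IsUnit (R x).det := fun x => by
    rw [det_of_isUpperTriangular (fun i j hij => (hR x).1 i j hij)]
    simp [(hR x).2]
  set N : ∀ a : A, Matrix (Fin (n (tgt a))) (Fin (n (src a))) ℂ :=
    fun a => (R (tgt a))⁻¹ * (r a * R (src a)) with hN
  have hRN : ∀ a, R (tgt a) * N a = r a * R (src a) := fun a =>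
    mul_nonsing_inv_cancel_left _ _ (hdet _)
  let e : ∀ x, Fin (n x) → ℂ := fun x j => if D x (w x j) ≤ c then 1 else 0
  have hzero : ∀ a j, D (src a) (w (src a) j) ≤ c → ∀ i, c < D (tgt a) (w (tgt a) i) →
      N a i j = 0 := by
    intro a j hj
    refine (hw (tgt a)).eq_zero_of_mulVec (P := fun i => c < D (tgt a) i)
      (fun i k hik hk => hk.trans_le (hD _ hik)) (d := fun i => N a i j) fun b hb => ?_
    have h1 : ((U (tgt a) * R (tgt a)) *ᵥ fun i => N a i j) =
        fun i => (ρ a * (U (src a) * R (src a))) i j := by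
      have : ((U (tgt a) * R (tgt a)) * N a) = ρ a * (U (src a) * R (src a)) := by
        rw [Matrix.mul_assoc, hRN, ← Matrix.mul_assoc, hρ, Matrix.mul_assoc]
      rw [← this]
      rfl
    rw [h1]
    change (ρ a * (U (src a) * R (src a))) _ j = 0
    rw [mul_apply]
    refine Finset.sum_eq_zero fun k _ => ?_
    rcases lt_or_ge k (w (src a) j) with hk | hk
    · rw [(hw _).2.1 j k hk, mul_zero]
    · rw [mul_eq_zero]
      left
      by_contra hne
      exact absurd (((hfeas a _ k hne).trans (hD _ hk)).trans hj) (not_le.2 hb)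
  refine ⟨fun x => R x * diagonal (e x), fun a => N a * diagonal (e (src a)), fun x => ⟨?_, ?_, ?_⟩,
    fun a => ?_⟩
  · intro i j hij
    change (R x * diagonal (e x)) i j = 0
    rw [mul_diagonal, (hR x).1 i j hij, zero_mul]
  · intro j hj
    change (R x * diagonal (e x)) j j = 1
    rw [mul_diagonal, (hR x).2]
    simp [e, (Finset.mem_filter.1 hj).2]
  · intro i j hj
    change (R x * diagonal (e x)) i j = 0
    rw [mul_diagonal]
    simp only [Finset.mem_filter, Finset.mem_univ, true_and] at hj
    simp [e, hj]
  · have h1 : N a * diagonal (e (src a)) =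
        diagonal (e (tgt a)) * (N a * diagonal (e (src a))) := by
      ext i j
      rw [diagonal_mul, mul_diagonal]
      simp only [e]
      split_ifs with h1 h2 h2 <;> simp
      exact hzero a j h1 i (not_le.1 h2)
    calc r a * (R (src a) * diagonal (e (src a)))
        = R (tgt a) * (N a * diagonal (e (src a))) := by
          rw [← Matrix.mul_assoc, ← hRN, Matrix.mul_assoc]
      _ = R (tgt a) * diagonal (e (tgt a)) * (N a * diagonal (e (src a))) := by
          rw [Matrix.mul_assoc (R (tgt a)), ← h1]

lemma NoCycles.exists_height {V A : Type} [Fintype V] {src tgt : A → V} (h : NoCycles src tgt) :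
    ∃ d : V → ℕ, ∀ a, d (src a) < d (tgt a) := by
  let E : V → V → Prop := fun z x => ∃ a, src a = z ∧ tgt a = x
  have hpath : ∀ z x, Relation.TransGen E z x → ∃ (k : ℕ) (f : Fin (k + 1) → A),
      (∀ i : Fin k, tgt (f i.castSucc) = src (f i.succ)) ∧ src (f 0) = z ∧
        tgt (f (Fin.last k)) = x := by
    intro z x hzx
    induction hzx with
    | single h =>
      obtain ⟨a, h1, h2⟩ := h
      exact ⟨0, fun _ => a, fun i => i.elim0, h1, h2⟩
    | tail _ h ih =>
      obtain ⟨a, h1, h2⟩ := h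
      obtain ⟨k, f, hf, hz, hb⟩ := ih
      refine ⟨k + 1, Fin.snoc (α := fun _ => A) f a, fun i => ?_, ?_, ?_⟩
      · induction i using Fin.lastCases with
        | last => rw [Fin.snoc_castSucc, Fin.succ_last, Fin.snoc_last, hb, h1]
        | cast i => rw [Fin.snoc_castSucc, Fin.succ_castSucc, Fin.snoc_castSucc, hf]
      · rw [← Fin.castSucc_zero, Fin.snoc_castSucc, hz]
      · rw [Fin.snoc_last, h2]
  have hirr : ∀ x, ¬ Relation.TransGen E x x := fun x hx => by
    obtain ⟨k, f, hf, hz, hb⟩ := hpath x x hx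
    exact h k f hf (hb.trans hz.symm)
  refine ⟨fun x => {z | Relation.TransGen E z x}.ncard, fun a => Set.ncard_lt_ncard ?_⟩
  refine ⟨fun z hz => hz.tail ⟨a, rfl, rfl⟩, fun hsub => hirr (src a) (hsub ?_)⟩
  exact Relation.TransGen.single ⟨a, rfl, rfl⟩

lemma sum_mul_nonneg_of_sublevel {ι : Type} [Fintype ι] {l d : ι → ℝ} (h0 : ∑ s, l s = 0)
    (h : ∀ c, ∑ s with d s ≤ c, l s ≤ 0) : 0 ≤ ∑ s, l s * d s := by
  obtain ⟨m, hm⟩ : ∃ m, ∀ s, m < d s := by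
    obtain ⟨m, hm⟩ := (Set.finite_range d).bddBelow
    exact ⟨m - 1, fun s => (sub_one_lt m).trans_le (hm ⟨s, rfl⟩)⟩
  obtain ⟨M, hM⟩ : ∃ M, ∀ s, d s ≤ M := by
    obtain ⟨M, hM⟩ := (Set.finite_range d).bddAbove
    exact ⟨M, fun s => hM ⟨s, rfl⟩⟩
  have h1 : ∀ s, ∫ c in Set.Ioc m M, (Set.Ici (d s)).indicator (1 : ℝ → ℝ) c = M - d s := by
    intro s
    rw [MeasureTheory.integral_indicator_one measurableSet_Ici,
      MeasureTheory.measureReal_restrict_apply measurableSet_Ici]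
    have : Set.Ici (d s) ∩ Set.Ioc m M = Set.Icc (d s) M := by
      ext c
      simp only [Set.mem_inter_iff, Set.mem_Ici, Set.mem_Ioc, Set.mem_Icc]
      exact ⟨fun h => ⟨h.1, h.2.2⟩, fun h => ⟨h.1, (hm s).trans_le h.1, h.2⟩⟩
    rw [this, Real.volume_real_Icc_of_le (hM s)]
  have h2 : ∑ s, l s * d s =
      -∫ c in Set.Ioc m M, ∑ s, l s * (Set.Ici (d s)).indicator (1 : ℝ → ℝ) c := by
    rw [MeasureTheory.integral_finsetSum]
    · simp only [MeasureTheory.integral_const_mul, h1, mul_sub, Finset.sum_sub_distrib]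
      rw [← Finset.sum_mul, h0]
      ring
    · intro s _
      refine MeasureTheory.Integrable.const_mul ?_ _
      exact (MeasureTheory.integrable_const (1 : ℝ)).indicator measurableSet_Ici
  rw [h2, Left.nonneg_neg_iff]
  refine MeasureTheory.integral_nonpos fun c => ?_
  refine le_trans (le_of_eq ?_) (h c)
  rw [Finset.sum_filter]
  refine Finset.sum_congr rfl fun s _ => ?_
  simp [Set.indicator_apply]

lemma abel_lower_bound {n : ℕ} {l a : Fin n → ℝ} (hl : Antitone l) {B C : ℝ}
    (hB0 : 0 ≤ B) (hB : ∀ j, |l j| ≤ B) (ha : ∀ m ≤ n, -C ≤ ∑ j with (j : Fin n).val < m, a j)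
    (h0 : ∑ j, a j = 0) : -(2 * B * C) ≤ ∑ j, l j * a j := by
  have key : ∀ (m : ℕ) (ν : ℝ), ν ≤ B → (∀ j : Fin n, (j : ℕ) < m → ν ≤ l j) →
      -(C * (B - ν)) ≤ ∑ j with (j : Fin n).val < m, (l j - ν) * a j := by
    intro m
    induction m with
    | zero =>
      intro ν hν _
      have hC : -C ≤ 0 := by simpa using ha 0 (Nat.zero_le n)
      simp only [not_lt_zero, Finset.filter_false, Finset.sum_empty]
      nlinarith
    | succ m ih =>
      intro ν hν hνl
      by_cases hm : m < n
      · have e : Finset.univ.filter (fun j : Fin n => (j : ℕ) < m + 1) =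
            insert ⟨m, hm⟩ (Finset.univ.filter fun j : Fin n => (j : ℕ) < m) := by
          ext j
          simp only [Finset.mem_filter, Finset.mem_univ, true_and, Finset.mem_insert, Fin.ext_iff]
          lia
        have h1 := ih (l ⟨m, hm⟩) ((le_abs_self _).trans (hB _))
          fun j hj => hl (Fin.le_def.2 hj.le)
        have h2 := ha (m + 1) hm
        have h3 := hνl ⟨m, hm⟩ (Nat.lt_succ_self m)
        have e2 : ∑ j with (j : Fin n).val < m + 1, (l j - ν) * a j =
            ∑ j with (j : Fin n).val < m, (l j - l ⟨m, hm⟩) * a j +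
              (l ⟨m, hm⟩ - ν) * ∑ j with (j : Fin n).val < m + 1, a j := by
          have e3 : ∑ j with (j : Fin n).val < m, (l j - l ⟨m, hm⟩) * a j =
              ∑ j with (j : Fin n).val < m + 1, (l j - l ⟨m, hm⟩) * a j := by
            rw [e, Finset.sum_insert (by simp)]
            simp
          rw [e3, Finset.mul_sum, ← Finset.sum_add_distrib]
          exact Finset.sum_congr rfl fun j _ => by ring
        rw [e2]
        nlinarith
      · have e : Finset.univ.filter (fun j : Fin n => (j : ℕ) < m + 1) =
            Finset.univ.filter fun j : Fin n => (j : ℕ) < m := by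
          ext j
          have := j.2
          simp only [Finset.mem_filter, Finset.mem_univ, true_and]
          lia
        rw [e]
        exact ih ν hν fun j hj => hνl j (Nat.lt_succ_of_lt hj)
  have h1 := key n (-B) (by linarith) fun j _ => (abs_le.1 (hB j)).1
  rw [Finset.filter_true_of_mem fun j _ => j.2] at h1
  have e : ∑ j, (l j - -B) * a j = ∑ j, l j * a j + B * ∑ j, a j := by
    rw [Finset.mul_sum, ← Finset.sum_add_distrib]
    exact Finset.sum_congr rfl fun j _ => by ring
  rw [e, h0] at h1
  linarith

open scoped ComplexOrder in
lemma exists_singular_value_decomposition {n : ℕ} (b : Matrix (Fin n) (Fin n) ℂ)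
    (hb : b.det ≠ 0) :
    ∃ (U W : Matrix (Fin n) (Fin n) ℂ) (D : Fin n → ℝ), Uᴴ * U = 1 ∧ Wᴴ * W = 1 ∧ Antitone D ∧
      b = U * diagonal (fun j => ((Real.exp (D j) : ℝ) : ℂ)) * W := by
  have hpos : (bᴴ * b).PosDef := by
    refine PosDef.conjTranspose_mul_self _ ?_
    exact mulVec_injective_iff_isUnit.2 ((isUnit_iff_isUnit_det b).2 (isUnit_iff_ne_zero.2 hb))
  set Q : Matrix (Fin n) (Fin n) ℂ := hpos.1.eigenvectorUnitary.1 with hQ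
  have hQQ : Qᴴ * Q = 1 := mem_unitaryGroup_iff'.1 hpos.1.eigenvectorUnitary.2
  have hspec : bᴴ * b = Q * diagonal (fun j => ((hpos.1.eigenvalues j : ℝ) : ℂ)) * Qᴴ :=
    hpos.1.spectral_theorem
  set σ := Tuple.sort fun j => -hpos.1.eigenvalues j
  have hσ : Monotone fun j => -hpos.1.eigenvalues (σ j) :=
    Tuple.monotone_sort fun j => -hpos.1.eigenvalues j
  have hep := hpos.eigenvalues_pos
  set D : Fin n → ℝ := fun j => Real.log (hpos.1.eigenvalues (σ j)) / 2 with hD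
  have hexp : ∀ j, hpos.1.eigenvalues (σ j) = Real.exp (D j) * Real.exp (D j) := fun j => by
    rw [← Real.exp_add, hD]
    simp only [add_halves]
    rw [Real.exp_log (hep _)]
  set P := Q.submatrix id σ with hP
  have hPP : Pᴴ * P = 1 := by
    have : Pᴴ * P = (Qᴴ * Q).submatrix σ σ := rfl
    rw [this, hQQ, submatrix_one_equiv]
  have hAP : bᴴ * b * P = P * diagonal (fun j => ((hpos.1.eigenvalues (σ j) : ℝ) : ℂ)) := by
    have h1 : bᴴ * b * Q = Q * diagonal (fun j => ((hpos.1.eigenvalues j : ℝ) : ℂ)) := by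
      refine (congrArg (· * Q) hspec).trans ?_
      simp only [Matrix.mul_assoc, hQQ, Matrix.mul_one]
    have h2 : bᴴ * b * P = (bᴴ * b * Q).submatrix id σ := rfl
    rw [h2, h1]
    ext i j
    rw [mul_diagonal, submatrix_apply, mul_diagonal]
    rfl
  have hPP' : P * Pᴴ = 1 := mul_eq_one_comm.1 hPP
  set e : Matrix (Fin n) (Fin n) ℂ := diagonal fun j => ((Real.exp (D j) : ℝ) : ℂ) with he
  set e' : Matrix (Fin n) (Fin n) ℂ := diagonal fun j => ((Real.exp (-D j) : ℝ) : ℂ) with he'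
  have hee : e' * e = 1 := by
    rw [he, he', diagonal_mul_diagonal, ← diagonal_one]
    congr 1
    ext j
    rw [← Complex.ofReal_mul, ← Real.exp_add]
    simp
  have hee2 : diagonal (fun j => ((hpos.1.eigenvalues (σ j) : ℝ) : ℂ)) = e * e := by
    rw [he, diagonal_mul_diagonal]
    congr 1
    ext j
    rw [hexp, Complex.ofReal_mul]
  have he'H : e'ᴴ = e' := by
    rw [he', diagonal_conjTranspose]
    congr 1
    ext j
    simp only [Pi.star_apply, RCLike.star_def, Complex.conj_ofReal]
  refine ⟨b * P * e', Pᴴ, D, ?_, ?_, ?_, ?_⟩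
  · calc (b * P * e')ᴴ * (b * P * e') = e'ᴴ * (Pᴴ * ((bᴴ * b * P) * e')) := by
          simp only [conjTranspose_mul, Matrix.mul_assoc]
      _ = e' * ((Pᴴ * P) * (e * e) * e') := by
          rw [hAP, hee2, he'H]
          simp only [Matrix.mul_assoc]
      _ = (e' * e) * (e * e') := by rw [hPP, Matrix.one_mul]; simp only [Matrix.mul_assoc]
      _ = 1 := by rw [hee, mul_eq_one_comm.1 hee, Matrix.one_mul]
  · rw [conjTranspose_conjTranspose, hPP']
  · intro i j hij
    have h1 := hσ hij
    simp only [neg_le_neg_iff] at h1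
    have := Real.log_le_log (hep _) h1
    simp only [hD]
    linarith
  · rw [Matrix.mul_assoc (b * P), hee, Matrix.mul_one, Matrix.mul_assoc, hPP', Matrix.mul_one]

/-- Membership in the group of invertible upper triangular matrices. -/
def IsBorel {n : ℕ} (b : Matrix (Fin n) (Fin n) ℂ) : Prop :=
  (∀ i j, j < i → b i j = 0) ∧ ∀ j, b j j ≠ 0

lemma IsBorel.det {n : ℕ} {b : Matrix (Fin n) (Fin n) ℂ} (hb : IsBorel b) :
    b.det = ∏ j, b j j :=
  det_of_isUpperTriangular fun i j hij => hb.1 i j hij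

lemma IsBorel.det_ne_zero {n : ℕ} {b : Matrix (Fin n) (Fin n) ℂ} (hb : IsBorel b) : b.det ≠ 0 := by
  rw [hb.det]
  exact Finset.prod_ne_zero_iff.2 fun j _ => hb.2 j

lemma norm_det_of_unitary {n : ℕ} {U : Matrix (Fin n) (Fin n) ℂ} (hU : Uᴴ * U = 1) :
    ‖U.det‖ = 1 := by
  have h := congrArg (fun M => ‖Matrix.det M‖) hU
  simp only [det_mul, det_conjTranspose, norm_mul, norm_star, det_one, norm_one] at h
  nlinarith [norm_nonneg U.det]

lemma norm_unitary_mul_mul_unitary_le {p q : ℕ} {U : Matrix (Fin p) (Fin p) ℂ}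
    {W : Matrix (Fin q) (Fin q) ℂ} (hU : Uᴴ * U = 1) (hW : Wᴴ * W = 1)
    {r : Matrix (Fin p) (Fin q) ℂ} {M : ℝ} (hr : ∀ i j, ‖r i j‖ ≤ M) (i : Fin p) (j : Fin q) :
    ‖(Uᴴ * r * W) i j‖ ≤ p * q * M := by
  have h1 : ∀ i j, ‖U i j‖ ≤ 1 := entry_norm_bound_of_unitary (mem_unitaryGroup_iff'.2 hU)
  have h2 : ∀ i j, ‖W i j‖ ≤ 1 := entry_norm_bound_of_unitary (mem_unitaryGroup_iff'.2 hW)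
  have h3 : ∀ k, ‖(Uᴴ * r) i k‖ ≤ p * M := fun k => by
    rw [mul_apply]
    refine (norm_sum_le _ _).trans ((Finset.sum_le_card_nsmul _ _ M fun l _ => ?_).trans (by simp))
    rw [norm_mul, conjTranspose_apply, norm_star]
    have := norm_nonneg (r l k)
    nlinarith [h1 l i, hr l k]
  rw [mul_apply]
  refine (norm_sum_le _ _).trans ((Finset.sum_le_card_nsmul _ _ (p * M) fun l _ => ?_).trans
    (le_of_eq (by simp only [Finset.card_univ, Fintype.card_fin, nsmul_eq_mul]; ring)))
  rw [norm_mul]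
  have := norm_nonneg ((Uᴴ * r) i l)
  nlinarith [h2 l j, h3 l]

lemma sum_log_diag_lower_bound {n : ℕ} {b U W : Matrix (Fin n) (Fin n) ℂ} {D : Fin n → ℝ}
    (hb : IsBorel b) (hU : Uᴴ * U = 1)
    (hbU : b = U * diagonal (fun j => ((Real.exp (D j) : ℝ) : ℂ)) * W)
    (w : Fin n → Fin n) {c : ℝ} (hc : 0 < c) (m : ℕ)
    (hminor : c ≤ ‖(W.submatrix (fun j : {j : Fin n // (j : ℕ) < m} => w j) Subtype.val).det‖) :
    -(Real.log n.factorial - Real.log c) ≤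
      ∑ j with (j : Fin n).val < m, (Real.log ‖b j j‖ - D (w j)) := by
  have h1 : Uᴴ * b = diagonal (fun j => ((Real.exp (D j) : ℝ) : ℂ)) * W := by
    rw [hbU, Matrix.mul_assoc, ← Matrix.mul_assoc, hU, Matrix.one_mul]
  have h2 := submatrix_mul_upper Uᴴ hb.1 w m
  have h3 : (diagonal (fun j => ((Real.exp (D j) : ℝ) : ℂ)) * W).submatrix
      (fun j : {j : Fin n // (j : ℕ) < m} => w j)
        (Subtype.val : {j : Fin n // (j : ℕ) < m} → Fin n) =
      diagonal (fun j : {j : Fin n // (j : ℕ) < m} => ((Real.exp (D (w j)) : ℝ) : ℂ)) *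
        W.submatrix (fun j : {j : Fin n // (j : ℕ) < m} => w j) Subtype.val := by
    ext i j
    rw [submatrix_apply, diagonal_mul, diagonal_mul, submatrix_apply]
  rw [h1, h3] at h2
  have h4 := congrArg (fun M => ‖Matrix.det M‖) h2
  have h5 : (b.submatrix (Subtype.val : {j : Fin n // (j : ℕ) < m} → Fin n) Subtype.val).det =
      ∏ j : {j : Fin n // (j : ℕ) < m}, b j j :=
    det_of_isUpperTriangular fun i j hij => hb.1 i j hij
  simp only [det_mul, det_diagonal, h5, norm_mul, norm_prod] at h4
  have hUe : ∀ i j, ‖U i j‖ ≤ 1 := entry_norm_bound_of_unitary (mem_unitaryGroup_iff'.2 hU)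
  have h6 : ‖(Uᴴ.submatrix (fun j : {j : Fin n // (j : ℕ) < m} => w j) Subtype.val).det‖ ≤
      n.factorial := by
    have := Matrix.det_le (abv := NormedField.toAbsoluteValue ℂ) (x := 1)
      (A := Uᴴ.submatrix (fun j : {j : Fin n // (j : ℕ) < m} => w j) Subtype.val) fun i j => by
        change ‖star (U _ _)‖ ≤ 1
        rw [norm_star]
        exact hUe _ _
    refine this.trans ?_
    simp only [one_pow, nsmul_eq_mul, mul_one, Nat.cast_le]
    refine Nat.factorial_le ?_
    exact (Fintype.card_subtype_le _).trans (by simp)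
  have hbpos : ∀ j : {j : Fin n // (j : ℕ) < m}, 0 < ‖b j j‖ := fun j => norm_pos_iff.2 (hb.2 _)
  have h7 : (∏ j : {j : Fin n // (j : ℕ) < m}, Real.exp (D (w j))) * c ≤
      n.factorial * ∏ j : {j : Fin n // (j : ℕ) < m}, ‖b j j‖ := by
    have hE : ∀ j : {j : Fin n // (j : ℕ) < m}, ‖((Real.exp (D (w j)) : ℝ) : ℂ)‖ =
        Real.exp (D (w j)) := fun j => by
      rw [Complex.norm_real, Real.norm_of_nonneg (Real.exp_pos _).le]
    simp only [hE] at h4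
    refine (mul_le_mul_of_nonneg_left hminor
      (Finset.prod_nonneg fun j _ => (Real.exp_pos _).le)).trans (h4.le.trans ?_)
    exact mul_le_mul_of_nonneg_right h6 (Finset.prod_nonneg fun j _ => (hbpos j).le)
  have h8 := Real.log_le_log (mul_pos (Finset.prod_pos fun j _ => Real.exp_pos _) hc) h7
  rw [Real.log_mul (Finset.prod_pos fun j _ => Real.exp_pos _).ne' hc.ne',
    Real.log_mul (by positivity) (Finset.prod_pos fun j _ => hbpos j).ne',
    Real.log_prod fun j _ => (Real.exp_pos _).ne', Real.log_prod fun j _ => (hbpos j).ne'] at h8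
  simp only [Real.log_exp] at h8
  rw [Finset.sum_subtype (p := fun j : Fin n => (j : ℕ) < m) _ (by simp), Finset.sum_sub_distrib]
  linarith

lemma sum_log_diag_eq {n : ℕ} {b U W : Matrix (Fin n) (Fin n) ℂ} {D : Fin n → ℝ}
    (hb : IsBorel b) (hU : Uᴴ * U = 1) (hW : Wᴴ * W = 1)
    (hbU : b = U * diagonal (fun j => ((Real.exp (D j) : ℝ) : ℂ)) * W) :
    ∑ j, Real.log ‖b j j‖ = ∑ j, D j := by
  have h1 := congrArg (fun M => Real.log ‖Matrix.det M‖) hbU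
  simp only [hb.det, det_mul, norm_mul, norm_det_of_unitary hU, norm_det_of_unitary hW,
    det_diagonal, norm_prod, one_mul, mul_one, Complex.norm_real, Real.norm_eq_abs,
    Real.abs_exp] at h1
  rw [Real.log_prod fun j _ => (norm_pos_iff.2 (hb.2 j)).ne',
    Real.log_prod fun j _ => (Real.exp_pos _).ne'] at h1
  simpa using h1

lemma weighted_log_diag_lower_bound {n : ℕ} {b U W : Matrix (Fin n) (Fin n) ℂ} {D : Fin n → ℝ}
    (hb : IsBorel b) (hU : Uᴴ * U = 1) (hW : Wᴴ * W = 1)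
    (hbU : b = U * diagonal (fun j => ((Real.exp (D j) : ℝ) : ℂ)) * W)
    {w : Fin n → Fin n} (hw : Function.Injective w) {c : ℝ} (hc : 0 < c)
    (hminor : ∀ m ≤ n,
      c ≤ ‖(W.submatrix (fun j : {j : Fin n // (j : ℕ) < m} => w j) Subtype.val).det‖)
    {l : Fin n → ℝ} (hl : Antitone l) {B : ℝ} (hB0 : 0 ≤ B) (hB : ∀ j, |l j| ≤ B) :
    ∑ j, l j * D (w j) - 2 * B * (Real.log n.factorial - Real.log c) ≤
      ∑ j, l j * Real.log ‖b j j‖ := by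
  have h1 := abel_lower_bound hl hB0 hB
    (fun m hm => sum_log_diag_lower_bound hb hU hbU w hc m (hminor m hm)) (by
      rw [Finset.sum_sub_distrib, sum_log_diag_eq hb hU hW hbU, sub_eq_zero]
      exact ((Equiv.ofBijective w (Finite.injective_iff_bijective.1 hw)).sum_comp D).symm)
  simp only [mul_sub, Finset.sum_sub_distrib] at h1
  linarith

lemma weighted_sum_nonneg_of_feasible {V A : Type} [Fintype V] [Finite A] {src tgt : A → V}
    {n : V → ℕ} {l : ∀ x : V, Fin (n x) → ℝ} (h0 : ∑ x, ∑ j, l x j = 0)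
    (hK : ∀ K : ∀ x : V, Finset (Fin (n x)), IsQIntersecting src tgt n K →
      ∑ x, ∑ j ∈ K x, l x j ≤ 0)
    {z : RepIdx src tgt n → ℂ} (hz : AlgebraicIndependent ℚ z)
    {U R : ∀ x, Matrix (Fin (n x)) (Fin (n x)) ℂ} {w : ∀ x, Fin (n x) → Fin (n x)}
    (hR : ∀ x, (∀ i j, j < i → R x i j = 0) ∧ ∀ j, R x j j = 1)
    (hw : ∀ x, IsLeading (U x * R x) (w x))
    {ρ : ∀ a : A, Matrix (Fin (n (tgt a))) (Fin (n (src a))) ℂ}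
    (hρ : ∀ a, U (tgt a) * repMat z a = ρ a * U (src a))
    {D : ∀ x, Fin (n x) → ℝ} (hD : ∀ x, Antitone (D x))
    (hfeas : ∀ a i j, ρ a i j ≠ 0 → D (tgt a) i ≤ D (src a) j) :
    0 ≤ ∑ x, ∑ j, l x j * D x (w x j) := by
  have h1 := sum_mul_nonneg_of_sublevel (ι := Σ x, Fin (n x)) (l := fun s => l s.1 s.2)
    (d := fun s => D s.1 (w s.1 s.2)) (by rw [Fintype.sum_sigma]; exact h0) fun c => by
      rw [Finset.sum_filter, Fintype.sum_sigma]
      simp only [← Finset.sum_filter]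
      exact hK _ ((hasCell_of_feasible hR hw hρ hD hfeas c).isQIntersecting hz)
  rwa [Fintype.sum_sigma] at h1

lemma weighted_sum_lower_bound_of_almost_feasible {V A : Type} [Fintype V] [Finite A]
    {src tgt : A → V} {n : V → ℕ} {l : ∀ x : V, Fin (n x) → ℝ} (h0 : ∑ x, ∑ j, l x j = 0)
    (hK : ∀ K : ∀ x : V, Finset (Fin (n x)), IsQIntersecting src tgt n K →
      ∑ x, ∑ j ∈ K x, l x j ≤ 0)
    {d : V → ℕ} (hd : ∀ a, d (src a) < d (tgt a))
    {z : RepIdx src tgt n → ℂ} (hz : AlgebraicIndependent ℚ z)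
    {U R : ∀ x, Matrix (Fin (n x)) (Fin (n x)) ℂ} {w : ∀ x, Fin (n x) → Fin (n x)}
    (hR : ∀ x, (∀ i j, j < i → R x i j = 0) ∧ ∀ j, R x j j = 1)
    (hw : ∀ x, IsLeading (U x * R x) (w x))
    {ρ : ∀ a : A, Matrix (Fin (n (tgt a))) (Fin (n (src a))) ℂ}
    (hρ : ∀ a, U (tgt a) * repMat z a = ρ a * U (src a))
    {D : ∀ x, Fin (n x) → ℝ} (hD : ∀ x, Antitone (D x)) {t : ℝ} (ht : 0 ≤ t)
    (hfeas : ∀ a i j, ρ a i j ≠ 0 → D (tgt a) i ≤ D (src a) j + t) :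
    -(|∑ x, d x * ∑ j, l x j| * t) ≤ ∑ x, ∑ j, l x j * D x (w x j) := by
  have h1 := weighted_sum_nonneg_of_feasible h0 hK hz hR hw hρ
    (D := fun x j => D x j - t * d x) (fun x i j hij => sub_le_sub_right (hD x hij) _)
    fun a i j hij => by
      have h2 := hfeas a i j hij
      have h3 : ((d (src a) : ℝ)) + 1 ≤ d (tgt a) := by exact_mod_cast hd a
      nlinarith
  have h2 : ∑ x, ∑ j, l x j * (D x (w x j) - t * d x) =
      ∑ x, ∑ j, l x j * D x (w x j) - t * ∑ x, d x * ∑ j, l x j := by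
    rw [Finset.mul_sum, ← Finset.sum_sub_distrib]
    refine Finset.sum_congr rfl fun x _ => ?_
    rw [Finset.mul_sum, Finset.mul_sum, ← Finset.sum_sub_distrib]
    exact Finset.sum_congr rfl fun j _ => by ring
  simp only [h2] at h1
  have h3 := neg_abs_le (∑ x, (d x : ℝ) * ∑ j, l x j)
  nlinarith

lemma exists_pos_le_of_finite {ι X : Type} [Finite ι] {F : Filter X} {f : ι → X → ℝ}
    (h : ∀ i, ∃ c > 0, ∀ᶠ y in F, c ≤ f i y) : ∃ c > 0, ∀ᶠ y in F, ∀ i, c ≤ f i y := by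
  have h1 : ∀ᶠ c in nhdsWithin (0 : ℝ) (Set.Ioi 0), ∀ i, ∀ᶠ y in F, c ≤ f i y := by
    rw [Filter.eventually_all]
    intro i
    obtain ⟨c, hc, hy⟩ := h i
    filter_upwards [Ioo_mem_nhdsGT hc] with c' hc'
    exact hy.mono fun y hy => hc'.2.le.trans hy
  obtain ⟨c, hc, hpos⟩ := (h1.and self_mem_nhdsWithin).exists
  exact ⟨c, hpos, Filter.eventually_all.2 hc⟩

lemma exists_pos_le_norm {X E : Type} [TopologicalSpace X] [NormedAddCommGroup E] {f : X → E}
    (hf : Continuous f) {y₀ : X} (h : f y₀ ≠ 0) : ∃ c > 0, ∀ᶠ y in nhds y₀, c ≤ ‖f y‖ := by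
  have hpos := norm_pos_iff.2 h
  refine ⟨‖f y₀‖ / 2, half_pos hpos, ?_⟩
  exact (hf.norm.continuousAt.eventually_const_lt (half_lt_self hpos)).mono fun _ => le_of_lt

/-- A lower bound for `∑ λ log |b_jj|` in terms of the size of `b • r₀`, valid for those `b`
whose singular value decomposition has its right unitary factor in `S`. -/
def HasLogBound {V A : Type} [Fintype V] {src tgt : A → V} {n : V → ℕ}
    (l : ∀ x : V, Fin (n x) → ℝ) (z : RepIdx src tgt n → ℂ)
    (S : Set (∀ x, Matrix (Fin (n x)) (Fin (n x)) ℂ)) : Prop :=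
  ∃ a₁ ≥ 0, ∃ a₀ : ℝ, ∀ W ∈ S, (∀ x, (W x)ᴴ * W x = 1) →
    ∀ (b U : ∀ x, Matrix (Fin (n x)) (Fin (n x)) ℂ) (D : ∀ x, Fin (n x) → ℝ)
      (r : ∀ a : A, Matrix (Fin (n (tgt a))) (Fin (n (src a))) ℂ) (M : ℝ), 0 ≤ M →
      (∀ x, IsBorel (b x)) → (∀ x, (U x)ᴴ * U x = 1) → (∀ x, Antitone (D x)) →
      (∀ x, b x = U x * diagonal (fun j => ((Real.exp (D x j) : ℝ) : ℂ)) * W x) →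
      (∀ a, r a * b (src a) = b (tgt a) * repMat z a) → (∀ a i j, ‖r a i j‖ ≤ M) →
      -(a₁ * M) - a₀ ≤ ∑ x, ∑ j, l x j * Real.log ‖b x j j‖

lemma conj_entry_eq {p q : ℕ} {b U W : Matrix (Fin p) (Fin p) ℂ} {D : Fin p → ℝ}
    {b' U' W' : Matrix (Fin q) (Fin q) ℂ} {D' : Fin q → ℝ} {r r₀ : Matrix (Fin p) (Fin q) ℂ}
    (hU : Uᴴ * U = 1) (hW' : W'ᴴ * W' = 1)
    (hb : b = U * diagonal (fun j => ((Real.exp (D j) : ℝ) : ℂ)) * W)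
    (hb' : b' = U' * diagonal (fun j => ((Real.exp (D' j) : ℝ) : ℂ)) * W')
    (hr : r * b' = b * r₀) (i : Fin p) (j : Fin q) :
    (Uᴴ * r * U') i j * ((Real.exp (D' j) : ℝ) : ℂ) =
      ((Real.exp (D i) : ℝ) : ℂ) * (W * r₀ * W'ᴴ) i j := by
  have hW2 : W' * W'ᴴ = 1 := mul_eq_one_comm.1 hW'
  have h : Uᴴ * r * U' * diagonal (fun j => ((Real.exp (D' j) : ℝ) : ℂ)) =
      diagonal (fun j => ((Real.exp (D j) : ℝ) : ℂ)) * (W * r₀ * W'ᴴ) := by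
    calc Uᴴ * r * U' * diagonal (fun j => ((Real.exp (D' j) : ℝ) : ℂ))
        = Uᴴ * (r * b') * W'ᴴ := by
          rw [hb']
          simp only [Matrix.mul_assoc, hW2, Matrix.mul_one]
      _ = Uᴴ * U * (diagonal (fun j => ((Real.exp (D j) : ℝ) : ℂ)) * (W * r₀ * W'ᴴ)) := by
          rw [hr, hb]
          simp only [Matrix.mul_assoc]
      _ = _ := by rw [hU, Matrix.one_mul]
  have := congrFun (congrFun h i) j
  rwa [mul_diagonal, diagonal_mul] at this

lemma hasLogBound_nhds {V A : Type} [Fintype V] [Finite A] {src tgt : A → V}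
    {n : V → ℕ} {l : ∀ x : V, Fin (n x) → ℝ} (hl : ∀ x, Antitone (l x))
    (h0 : ∑ x, ∑ j, l x j = 0)
    (hK : ∀ K : ∀ x : V, Finset (Fin (n x)), IsQIntersecting src tgt n K →
      ∑ x, ∑ j ∈ K x, l x j ≤ 0)
    {d : V → ℕ} (hd : ∀ a, d (src a) < d (tgt a))
    {z : RepIdx src tgt n → ℂ} (hz : AlgebraicIndependent ℚ z)
    {W₀ : ∀ x, Matrix (Fin (n x)) (Fin (n x)) ℂ} (hW₀ : ∀ x, (W₀ x)ᴴ * W₀ x = 1) :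
    ∃ S ∈ nhds W₀, HasLogBound l z S := by
  have hdet : ∀ x, (W₀ x).det ≠ 0 := fun x h => by
    have := norm_det_of_unitary (hW₀ x)
    simp [h] at this
  choose R w hR1 hR2 hw using fun x => exists_isLeading (W₀ x) (hdet x)
  have hcont : ∀ x, Continuous fun W : ∀ x, Matrix (Fin (n x)) (Fin (n x)) ℂ => W x :=
    fun x => continuous_apply x
  obtain ⟨c₁, hc₁, hc₁'⟩ := exists_pos_le_of_finite (F := nhds W₀)
    (ι := {s : RepIdx src tgt n //
      (W₀ (tgt s.1) * repMat z s.1 * (W₀ (src s.1))ᴴ) s.2.1 s.2.2 ≠ 0})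
    (f := fun s W =>
      ‖(W (tgt s.1.1) * repMat z s.1.1 * (W (src s.1.1))ᴴ) s.1.2.1 s.1.2.2‖) fun s =>
      exists_pos_le_norm ((((hcont _).matrix_mul continuous_const).matrix_mul
        (hcont _).matrix_conjTranspose).matrix_elem _ _) s.2
  obtain ⟨c₂, hc₂, hc₂'⟩ := exists_pos_le_of_finite (F := nhds W₀)
    (ι := Σ x, Fin (n x + 1))
    (f := fun s W => ‖((W s.1).submatrix (fun j : {j : Fin (n s.1) // (j : ℕ) < s.2} => w s.1 j)
      Subtype.val).det‖) fun s =>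
      exists_pos_le_norm ((hcont s.1).matrix_submatrix _ _).matrix_det
        ((hw s.1).minor_ne_zero (hR1 s.1) s.2)
  obtain ⟨N, hN⟩ : ∃ N : ℝ, ∀ a : A, (n (tgt a) : ℝ) * n (src a) ≤ N := by
    obtain ⟨N, hN⟩ := (Set.finite_range fun a : A => (n (tgt a) : ℝ) * n (src a)).bddAbove
    exact ⟨N, fun a => hN ⟨a, rfl⟩⟩
  obtain ⟨B, hB⟩ : ∃ B : ℝ, ∀ s : Σ x, Fin (n x), |l s.1 s.2| ≤ B := by
    obtain ⟨B, hB⟩ := (Set.finite_range fun s : Σ x, Fin (n x) => |l s.1 s.2|).bddAbove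
    exact ⟨B, fun s => hB ⟨s, rfl⟩⟩
  set L := |∑ x, (d x : ℝ) * ∑ j, l x j|
  refine ⟨_, hc₁'.and hc₂', L * (max N 0 / c₁), by positivity,
    ∑ x, 2 * max B 0 * (Real.log (n x).factorial - Real.log c₂), ?_⟩
  rintro W ⟨hWρ, hWm⟩ hW b U D r M hM hb hU hD hbU hr hrM
  have h1 := weighted_sum_lower_bound_of_almost_feasible h0 hK hd hz
    (U := W₀) (R := R) (w := w) (fun x => ⟨hR1 x, hR2 x⟩) hw
    (ρ := fun a => W₀ (tgt a) * repMat z a * (W₀ (src a))ᴴ) (fun a => by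
      rw [Matrix.mul_assoc _ (W₀ (src a))ᴴ, hW₀, Matrix.mul_one]) hD
    (t := max N 0 / c₁ * M) (by positivity) fun a i j hij => by
      have h2 := hWρ ⟨⟨a, (i, j)⟩, hij⟩
      have h3 := congrArg norm (conj_entry_eq (hU _) (hW _) (hbU _) (hbU _) (hr a) i j)
      have h4 := norm_unitary_mul_mul_unitary_le (hU (tgt a)) (hU (src a)) (hrM a) i j
      simp only [norm_mul, Complex.norm_real, Real.norm_eq_abs, Real.abs_exp] at h3
      have h5 : (n (tgt a) : ℝ) * n (src a) * M ≤ max N 0 * M :=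
        mul_le_mul_of_nonneg_right ((hN a).trans (le_max_left _ _)) hM
      have h6 : Real.exp (D (tgt a) i) * c₁ ≤ max N 0 * M * Real.exp (D (src a) j) := by
        refine (mul_le_mul_of_nonneg_left h2 (Real.exp_pos _).le).trans (h3.symm.le.trans ?_)
        exact mul_le_mul_of_nonneg_right (h4.trans h5) (Real.exp_pos _).le
      have h7 : Real.exp (D (tgt a) i - D (src a) j) ≤ max N 0 / c₁ * M := by
        rw [Real.exp_sub, div_le_iff₀ (Real.exp_pos _), div_mul_eq_mul_div, div_mul_eq_mul_div,
          le_div_iff₀ hc₁]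
        exact h6
      linarith [Real.add_one_le_exp (D (tgt a) i - D (src a) j)]
  have h2 : ∀ x, _ := fun x => weighted_log_diag_lower_bound (hb x) (hU x) (hW x) (hbU x)
    (hw x).1 hc₂ (fun m hm => hWm ⟨x, ⟨m, Nat.lt_succ_of_le hm⟩⟩) (hl x)
    (le_max_right B 0) (fun j => (hB ⟨x, j⟩).trans (le_max_left _ _))
  have h3 := Finset.sum_le_sum fun x (_ : x ∈ Finset.univ) => h2 x
  rw [Finset.sum_sub_distrib] at h3
  refine le_trans ?_ h3
  have : L * (max N 0 / c₁) * M = L * (max N 0 / c₁ * M) := by ring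
  rw [this]
  exact sub_le_sub_right h1 _

lemma exists_log_bound {V A : Type} [Fintype V] [Finite A] {src tgt : A → V}
    {n : V → ℕ} {l : ∀ x : V, Fin (n x) → ℝ} (hl : ∀ x, Antitone (l x))
    (h0 : ∑ x, ∑ j, l x j = 0)
    (hK : ∀ K : ∀ x : V, Finset (Fin (n x)), IsQIntersecting src tgt n K →
      ∑ x, ∑ j ∈ K x, l x j ≤ 0)
    {d : V → ℕ} (hd : ∀ a, d (src a) < d (tgt a))
    {z : RepIdx src tgt n → ℂ} (hz : AlgebraicIndependent ℚ z) :
    ∃ a₁ ≥ 0, ∃ a₀ : ℝ, ∀ (b : ∀ x, Matrix (Fin (n x)) (Fin (n x)) ℂ)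
      (r : ∀ a : A, Matrix (Fin (n (tgt a))) (Fin (n (src a))) ℂ) (M : ℝ), 0 ≤ M →
      (∀ x, IsBorel (b x)) → (∀ a, r a * b (src a) = b (tgt a) * repMat z a) →
      (∀ a i j, ‖r a i j‖ ≤ M) → -(a₁ * M) - a₀ ≤ ∑ x, ∑ j, l x j * Real.log ‖b x j j‖ := by
  set S : Set (∀ x, Matrix (Fin (n x)) (Fin (n x)) ℂ) := {W | ∀ x, (W x)ᴴ * W x = 1} with hS
  have hSc : IsCompact S := by
    refine (isCompact_norm_le_one n).of_isClosed_subset ?_ fun W hW x i j =>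
      entry_norm_bound_of_unitary (mem_unitaryGroup_iff'.2 (hW x)) i j
    simp only [hS, Set.ofPred_forall]
    exact isClosed_iInter fun x => isClosed_eq (by fun_prop) continuous_const
  have hbd : HasLogBound l z S := by
    refine hSc.induction_on (p := HasLogBound l z) ?_ ?_ ?_ ?_
    · exact ⟨0, le_rfl, 0, fun W hW => hW.elim⟩
    · rintro s t hst ⟨a₁, h1, a₀, h⟩
      exact ⟨a₁, h1, a₀, fun W hW => h W (hst hW)⟩
    · rintro s t ⟨a₁, h1, a₀, h⟩ ⟨a₁', h1', a₀', h'⟩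
      refine ⟨max a₁ a₁', h1.le.trans (le_max_left _ _), max a₀ a₀', ?_⟩
      rintro W (hW | hW) hWu b U D r M hM hb hU hD hbU hr hrM
      · refine le_trans ?_ (h W hW hWu b U D r M hM hb hU hD hbU hr hrM)
        have := mul_le_mul_of_nonneg_right (le_max_left a₁ a₁') hM
        linarith [le_max_left a₀ a₀']
      · refine le_trans ?_ (h' W hW hWu b U D r M hM hb hU hD hbU hr hrM)
        have := mul_le_mul_of_nonneg_right (le_max_right a₁ a₁') hM
        linarith [le_max_right a₀ a₀']
    · intro W hW
      obtain ⟨T, hT, h⟩ := hasLogBound_nhds hl h0 hK hd hz hW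
      exact ⟨T, mem_nhdsWithin_of_mem_nhds hT, h⟩
  obtain ⟨a₁, h1, a₀, h⟩ := hbd
  refine ⟨a₁, h1, a₀, fun b r M hM hb hr hrM => ?_⟩
  choose U W D hU hW hD hbU using fun x =>
    exists_singular_value_decomposition (b x) (hb x).det_ne_zero
  exact h W hW hW b U D r M hM hb hU hD hbU hr hrM

lemma IsBorel.one {n : ℕ} : IsBorel (1 : Matrix (Fin n) (Fin n) ℂ) :=
  ⟨fun _ _ hij => one_apply_ne hij.ne', fun j => by simp⟩

lemma IsBorel.mul_diag {n : ℕ} {b c : Matrix (Fin n) (Fin n) ℂ} (hb : IsBorel b)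
    (hc : IsBorel c) (j : Fin n) : (b * c) j j = b j j * c j j := by
  rw [mul_apply, Finset.sum_eq_single j]
  · intro k _ hkj
    rcases lt_or_gt_of_ne hkj with h | h
    · rw [hb.1 j k h, zero_mul]
    · rw [hc.1 k j h, mul_zero]
  · simp

lemma IsBorel.mul {n : ℕ} {b c : Matrix (Fin n) (Fin n) ℂ} (hb : IsBorel b)
    (hc : IsBorel c) : IsBorel (b * c) := by
  refine ⟨fun i j hij => ?_, fun j => ?_⟩
  · rw [mul_apply]
    refine Finset.sum_eq_zero fun k _ => ?_
    rcases lt_or_ge k i with h | h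
    · rw [hb.1 i k h, zero_mul]
    · rw [hc.1 k j (hij.trans_le h), mul_zero]
  · rw [hb.mul_diag hc]
    exact mul_ne_zero (hb.2 j) (hc.2 j)

lemma exists_minimizer {V A : Type} [Fintype V] [Fintype A] {src tgt : A → V}
    {n : V → ℕ} {l : ∀ x : V, Fin (n x) → ℝ} (hl : ∀ x, Antitone (l x))
    (h0 : ∑ x, ∑ j, l x j = 0)
    (hK : ∀ K : ∀ x : V, Finset (Fin (n x)), IsQIntersecting src tgt n K →
      ∑ x, ∑ j ∈ K x, l x j ≤ 0)
    {d : V → ℕ} (hd : ∀ a, d (src a) < d (tgt a)) :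
    ∃ r : ∀ a : A, Matrix (Fin (n (tgt a))) (Fin (n (src a))) ℂ,
      ∀ g : ∀ x, Matrix (Fin (n x)) (Fin (n x)) ℂ, (∀ x, IsBorel (g x)) →
        ∑ a, ∑ i, ∑ j, ‖r a i j‖ ^ 2 ≤
          ∑ a, ∑ i, ∑ j, ‖(g (tgt a) * r a * (g (src a))⁻¹) i j‖ ^ 2 +
            2 * ∑ x, ∑ j, l x j * Real.log ‖g x j j‖ := by
  obtain ⟨z, hz⟩ := (dense_algebraicIndependent (RepIdx src tgt n)).nonempty
  obtain ⟨a₁, ha₁, a₀, hbd⟩ := exists_log_bound hl h0 hK hd hz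
  set Z : Set ((RepIdx src tgt n → ℂ) × ℝ) := {p | ∃ b : ∀ x, Matrix (Fin (n x)) (Fin (n x)) ℂ,
    (∀ x, IsBorel (b x)) ∧ (∀ a, repMat p.1 a * b (src a) = b (tgt a) * repMat z a) ∧
      p.2 = ∑ x, ∑ j, l x j * Real.log ‖b x j j‖} with hZ
  have hzZ : (z, (0 : ℝ)) ∈ closure Z :=
    subset_closure ⟨fun _ => 1, fun _ => IsBorel.one, fun a => by simp, by simp⟩
  have hlow : ∀ p ∈ closure Z, -(a₁ * ‖p.1‖) - a₀ ≤ p.2 := by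
    have hcl : IsClosed {p : (RepIdx src tgt n → ℂ) × ℝ | -(a₁ * ‖p.1‖) - a₀ ≤ p.2} :=
      isClosed_le (by fun_prop) (by fun_prop)
    refine fun p hp => closure_minimal ?_ hcl hp
    rintro p ⟨b, hb, hpb, hs⟩
    change _ ≤ p.2
    rw [hs]
    exact hbd b _ _ (norm_nonneg _) hb hpb fun a i j => norm_le_pi_norm p.1 ⟨a, (i, j)⟩
  set F : (RepIdx src tgt n → ℂ) × ℝ → ℝ := fun p => ∑ i, ‖p.1 i‖ ^ 2 + 2 * p.2 with hF
  have hFc : Continuous F := by fun_prop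
  have hnorm : ∀ x : RepIdx src tgt n → ℂ, ‖x‖ ^ 2 ≤ ∑ i, ‖x i‖ ^ 2 := fun x => by
    have h1 : ‖x‖ ≤ √(∑ i, ‖x i‖ ^ 2) := by
      rw [pi_norm_le_iff_of_nonneg (Real.sqrt_nonneg _)]
      exact fun i => Real.le_sqrt_of_sq_le
        (Finset.single_le_sum (f := fun i => ‖x i‖ ^ 2) (fun i _ => sq_nonneg _)
          (Finset.mem_univ i))
    calc ‖x‖ ^ 2 ≤ √(∑ i, ‖x i‖ ^ 2) ^ 2 := pow_le_pow_left₀ (norm_nonneg _) h1 2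
      _ = _ := Real.sq_sqrt (Finset.sum_nonneg fun i _ => sq_nonneg _)
  set c := F (z, 0) with hc
  set ρ := 2 * a₁ + |c + 2 * a₀| + 1 with hρ
  have hsub : ∀ p ∈ closure Z, F p ≤ c →
      p ∈ Metric.closedBall (0 : RepIdx src tgt n → ℂ) ρ ×ˢ Set.Icc (-(a₁ * ρ) - a₀) (c / 2) := by
    intro p hp hpc
    have h1 := hlow p hp
    have h2 := hnorm p.1
    have h3 : ‖p.1‖ ^ 2 + 2 * p.2 ≤ c := (add_le_add_left h2 _).trans hpc
    have h4 : ‖p.1‖ ≤ ρ := by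
      by_contra! h
      have := le_abs_self (c + 2 * a₀)
      have := abs_nonneg (c + 2 * a₀)
      have := norm_nonneg p.1
      nlinarith
    refine ⟨by simpa using h4, ?_, ?_⟩
    · nlinarith
    · nlinarith [sq_nonneg ‖p.1‖]
  have hcomp : IsCompact (closure Z ∩
      Metric.closedBall (0 : RepIdx src tgt n → ℂ) ρ ×ˢ Set.Icc (-(a₁ * ρ) - a₀) (c / 2)) :=
    ((isCompact_closedBall _ _).prod isCompact_Icc).inter_left isClosed_closure
  obtain ⟨p, hp, hmin⟩ := hcomp.exists_isMinOn ⟨(z, 0), hzZ, hsub _ hzZ le_rfl⟩ hFc.continuousOn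
  have hmin' : ∀ q ∈ closure Z, F p ≤ F q := fun q hq => by
    rcases le_or_gt (F q) c with h | h
    · exact hmin ⟨hq, hsub q hq h⟩
    · exact (hmin ⟨hzZ, hsub _ hzZ le_rfl⟩).trans h.le
  refine ⟨repMat p.1, fun g hg => ?_⟩
  set Φ : (RepIdx src tgt n → ℂ) × ℝ → (RepIdx src tgt n → ℂ) × ℝ := fun q =>
    (fun i => (g (tgt i.1) * repMat q.1 i.1 * (g (src i.1))⁻¹) i.2.1 i.2.2,
      q.2 + ∑ x, ∑ j, l x j * Real.log ‖g x j j‖) with hΦ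
  have hΦc : Continuous Φ := by
    refine Continuous.prodMk (continuous_pi fun i => ?_) (by fun_prop)
    exact (((continuous_const.matrix_mul ((continuous_repMat i.1).comp continuous_fst)).matrix_mul
      continuous_const).matrix_elem _ _)
  have hΦZ : Set.MapsTo Φ Z Z := by
    rintro q ⟨b, hb, hq, hs⟩
    refine ⟨fun x => g x * b x, fun x => (hg x).mul (hb x), fun a => ?_, ?_⟩
    · change (g (tgt a) * repMat q.1 a * (g (src a))⁻¹) * (g (src a) * b (src a)) = _
      have hu : IsUnit (g (src a)).det := isUnit_iff_ne_zero.2 (hg _).det_ne_zero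
      rw [Matrix.mul_assoc, nonsing_inv_mul_cancel_left _ _ hu, Matrix.mul_assoc, hq,
        Matrix.mul_assoc]
    · change q.2 + _ = _
      rw [hs, ← Finset.sum_add_distrib]
      refine Finset.sum_congr rfl fun x _ => ?_
      rw [← Finset.sum_add_distrib]
      refine Finset.sum_congr rfl fun j _ => ?_
      change _ = l x j * Real.log ‖(g x * b x) j j‖
      rw [(hg x).mul_diag (hb x), norm_mul, Real.log_mul (norm_ne_zero_iff.2 ((hg x).2 j))
        (norm_ne_zero_iff.2 ((hb x).2 j))]
      ring
  have h1 := hmin' (Φ p) (map_mem_closure hΦc hp.1 hΦZ)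
  simp only [hF, hΦ, Fintype.sum_sigma, Fintype.sum_prod_type, mul_add] at h1
  simp only [repMat, of_apply] at h1 ⊢
  linarith

lemma hasDerivAt_div_one_add (κ : ℂ) :
    HasDerivAt (fun t : ℝ => (t : ℂ) / (1 + t * κ)) 1 0 := by
  have h1 : HasDerivAt (fun t : ℝ => (t : ℂ)) 1 0 := Complex.ofRealCLM.hasDerivAt
  have h2 : HasDerivAt (fun t : ℝ => 1 + (t : ℂ) * κ) κ 0 := by
    simpa using (h1.mul_const κ).const_add 1
  simpa using h1.fun_div h2 (by simp)

lemma hasDerivAt_log_norm_one_add (z : ℂ) :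
    HasDerivAt (fun t : ℝ => Real.log ‖1 + (t : ℂ) * z‖) z.re 0 := by
  have h1 : HasDerivAt (fun t : ℝ => (t : ℂ)) 1 0 := Complex.ofRealCLM.hasDerivAt
  have h2 : HasDerivAt (fun t : ℝ => 1 + (t : ℂ) * z) z 0 := by
    simpa using (h1.mul_const z).const_add 1
  have h3 := h2.clog_real (by simp)
  have h4 := Complex.reCLM.hasFDerivAt.comp_hasDerivAt (0 : ℝ) h3
  simpa [Function.comp_def, Complex.log_re] using h4

lemma hasDerivAt_norm_sq_curve (κ c₀ c₁ c₂ c₃ : ℂ) :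
    HasDerivAt (fun t : ℝ => ‖c₀ + t * c₁ - t / (1 + t * κ) * c₂ - t * (t / (1 + t * κ)) * c₃‖ ^ 2)
      (2 * (star c₀ * (c₁ - c₂)).re) 0 := by
  have h1 : HasDerivAt (fun t : ℝ => (t : ℂ)) 1 0 := Complex.ofRealCLM.hasDerivAt
  have hu := hasDerivAt_div_one_add κ
  have h := (((h1.mul_const c₁).const_add c₀).fun_sub (hu.mul_const c₂)).fun_sub
    ((h1.fun_mul hu).mul_const c₃)
  have h' := h.norm_sq
  simp only [Complex.inner] at h'
  convert h' using 1
  simp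
  ring

lemma eventually_isBorel_one_add {m : ℕ} {X : Matrix (Fin m) (Fin m) ℂ}
    (hX : ∀ i j, j < i → X i j = 0) : ∀ᶠ t : ℝ in nhds 0, IsBorel (1 + (t : ℂ) • X) := by
  have h : ∀ᶠ t : ℝ in nhds 0, ∀ j, (1 + (t : ℂ) • X) j j ≠ 0 := by
    refine Filter.eventually_all.2 fun j => ?_
    have hc : Continuous fun t : ℝ => (1 + (t : ℂ) • X) j j := by
      simp only [Matrix.add_apply, Matrix.smul_apply, smul_eq_mul]; fun_prop
    exact hc.continuousAt.eventually_ne (by simp)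
  filter_upwards [h] with t ht
  exact ⟨fun i j hij => by simp [hX i j hij, hij.ne'], ht⟩

lemma inv_one_add_smul {m : ℕ} {X : Matrix (Fin m) (Fin m) ℂ} {κ t : ℂ} (hX : X * X = κ • X)
    (ht : 1 + t * κ ≠ 0) : (1 + t • X)⁻¹ = 1 - (t / (1 + t * κ)) • X := by
  refine inv_eq_right_inv ?_
  have h : t - t / (1 + t * κ) - t * (t / (1 + t * κ)) * κ = 0 := by field_simp; ring
  calc (1 + t • X) * (1 - (t / (1 + t * κ)) • X)
      = 1 + (t - t / (1 + t * κ) - t * (t / (1 + t * κ)) * κ) • X := by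
        rw [add_mul, mul_sub, mul_sub, smul_mul_smul_comm, hX, smul_smul]
        simp only [mul_one, one_mul, sub_smul]
        abel
    _ = 1 := by rw [h, zero_smul, add_zero]

lemma first_order_condition {V A : Type} [Fintype V] [Fintype A] [DecidableEq V] {src tgt : A → V}
    {n : V → ℕ} {l : ∀ x, Fin (n x) → ℝ}
    {r : ∀ a : A, Matrix (Fin (n (tgt a))) (Fin (n (src a))) ℂ}
    (hr : ∀ g : ∀ x, Matrix (Fin (n x)) (Fin (n x)) ℂ, (∀ x, IsBorel (g x)) →
      ∑ a, ∑ i, ∑ j, ‖r a i j‖ ^ 2 ≤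
        ∑ a, ∑ i, ∑ j, ‖(g (tgt a) * r a * (g (src a))⁻¹) i j‖ ^ 2 +
          2 * ∑ x, ∑ j, l x j * Real.log ‖g x j j‖)
    {X : ∀ x, Matrix (Fin (n x)) (Fin (n x)) ℂ} (hX : ∀ x i j, j < i → X x i j = 0)
    {κ : ℂ} (hκ : ∀ x, X x * X x = κ • X x) :
    (∑ x, (X x * momentMap src tgt n r x).trace).re + ∑ x, ∑ j, l x j * (X x j j).re = 0 := by
  have hd : HasDerivAt (fun t : ℝ => ∑ a, ∑ i, ∑ j, ‖r a i j + t * (X (tgt a) * r a) i j -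
      t / (1 + t * κ) * (r a * X (src a)) i j -
      t * (t / (1 + t * κ)) * (X (tgt a) * r a * X (src a)) i j‖ ^ 2 +
      2 * ∑ x, ∑ j, l x j * Real.log ‖1 + (t : ℂ) * X x j j‖)
      (∑ a, ∑ i, ∑ j, 2 * (star (r a i j) * ((X (tgt a) * r a) i j - (r a * X (src a)) i j)).re +
        2 * ∑ x, ∑ j, l x j * (X x j j).re) 0 := by
    refine HasDerivAt.add ?_ (HasDerivAt.const_mul _ ?_)
    · exact HasDerivAt.fun_sum fun a _ => HasDerivAt.fun_sum fun i _ => HasDerivAt.fun_sum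
        fun j _ => hasDerivAt_norm_sq_curve _ _ _ _ _
    · exact HasDerivAt.fun_sum fun x _ => HasDerivAt.fun_sum fun j _ =>
        (hasDerivAt_log_norm_one_add _).const_mul _
  have hmin : IsLocalMin (fun t : ℝ => ∑ a, ∑ i, ∑ j, ‖r a i j + t * (X (tgt a) * r a) i j -
      t / (1 + t * κ) * (r a * X (src a)) i j -
      t * (t / (1 + t * κ)) * (X (tgt a) * r a * X (src a)) i j‖ ^ 2 +
      2 * ∑ x, ∑ j, l x j * Real.log ‖1 + (t : ℂ) * X x j j‖) 0 := by
    have hb : ∀ᶠ t : ℝ in nhds 0, ∀ x, IsBorel (1 + (t : ℂ) • X x) :=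
      Filter.eventually_all.2 fun x => eventually_isBorel_one_add (hX x)
    have hc : Continuous fun t : ℝ => 1 + (t : ℂ) * κ := by fun_prop
    filter_upwards [hb, hc.continuousAt.eventually_ne (show 1 + ((0 : ℝ) : ℂ) * κ ≠ 0 by simp)]
      with t ht htκ
    have h := hr _ ht
    refine (le_of_eq ?_).trans (h.trans (le_of_eq ?_))
    · simp
    · congr 1
      · refine Finset.sum_congr rfl fun a _ => Finset.sum_congr rfl fun i _ =>
          Finset.sum_congr rfl fun j _ => ?_
        rw [inv_one_add_smul (hκ _) htκ]
        congr 2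
        simp only [Matrix.add_mul, Matrix.mul_sub, Matrix.one_mul, Matrix.mul_one,
          Matrix.mul_smul, Matrix.smul_mul, Matrix.sub_apply, Matrix.add_apply, Matrix.smul_apply, smul_eq_mul]
        ring
      · simp
  have h := hmin.hasDerivAt_eq_zero hd
  have htr : ∑ a, ∑ i, ∑ j, (star (r a i j) * ((X (tgt a) * r a) i j - (r a * X (src a)) i j)) =
      ∑ x, (X x * momentMap src tgt n r x).trace := by
    rw [sum_trace_mul_momentMap]
    refine Finset.sum_congr rfl fun a _ => ?_
    rw [trace_mul_comm (X (src a)), ← Matrix.mul_assoc, Matrix.mul_assoc (r a)ᴴ,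
      trace_mul_comm (r a)ᴴ, ← trace_sub, ← Matrix.sub_mul]
    simp only [trace, diag_apply, Matrix.mul_apply (M := X (tgt a) * r a - r a * X (src a)),
      conjTranspose_apply, Matrix.sub_apply]
    exact Finset.sum_congr rfl fun i _ => Finset.sum_congr rfl fun j _ => mul_comm _ _
  rw [← htr]
  simp only [Complex.re_sum, ← Finset.mul_sum] at h ⊢
  linarith

lemma momentMap_conjTranspose {V A : Type} [Fintype A] [DecidableEq V] (src tgt : A → V)
    (n : V → ℕ) (r : ∀ a : A, Matrix (Fin (n (tgt a))) (Fin (n (src a))) ℂ) (x : V) :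
    (momentMap src tgt n r x)ᴴ = momentMap src tgt n r x := by
  simp only [momentMap, conjTranspose_sub, conjTranspose_sum]
  congr 1
  all_goals
    refine Finset.sum_congr rfl fun a _ => ?_
    split_ifs with h
    · subst h
      simp [conjTranspose_mul]
    · simp

lemma momentMap_eq_of_first_order {V A : Type} [Fintype V] [Fintype A] [DecidableEq V]
    {src tgt : A → V} {n : V → ℕ} {l : ∀ x, Fin (n x) → ℝ}
    {r : ∀ a : A, Matrix (Fin (n (tgt a))) (Fin (n (src a))) ℂ}
    (h : ∀ X : ∀ x, Matrix (Fin (n x)) (Fin (n x)) ℂ, (∀ x i j, j < i → X x i j = 0) →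
      ∀ κ : ℂ, (∀ x, X x * X x = κ • X x) →
      (∑ x, (X x * momentMap src tgt n r x).trace).re + ∑ x, ∑ j, l x j * (X x j j).re = 0)
    (x : V) : momentMap src tgt n r x = -diagonal fun j => (l x j : ℂ) := by
  set M := momentMap src tgt n r x with hM
  have key : ∀ (i j : Fin (n x)) (c : ℂ), i ≤ j →
      (c * M j i).re + (if i = j then l x i * c.re else 0) = 0 := by
    intro i j c hij
    have := h (Function.update 0 x (single i j c)) (fun y i' j' hlt => ?_)
      (if i = j then c else 0) (fun y => ?_)
    · rw [Finset.sum_eq_single x (fun y _ hy => by simp [hy]) (by simp),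
        Finset.sum_eq_single x (fun y _ hy => by simp [hy]) (by simp)] at this
      rw [Function.update_self, ← hM] at this
      convert this using 2
      · simp [trace_single_mul]
      · split_ifs with hij'
        · subst hij'
          rw [Finset.sum_eq_single i (fun j _ hj => by simp [hj.symm]) (by simp)]
          simp
        · symm
          refine Finset.sum_eq_zero fun k _ => ?_
          rw [single_apply, if_neg (fun hk => hij' (hk.1.trans hk.2.symm))]
          simp
    · by_cases hy : y = x
      · subst hy
        rw [Function.update_self, single_apply, if_neg]
        rintro ⟨rfl, rfl⟩
        exact absurd hij (not_le.2 hlt)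
      · simp [hy]
    · by_cases hy : y = x
      · subst hy
        rw [Function.update_self]
        split_ifs with hij'
        · subst hij'; simp
        · simp [single_mul_single_of_ne, Ne.symm hij']
      · simp [hy]
  have upper : ∀ i j : Fin (n x), i ≤ j → M j i = if i = j then -(l x i : ℂ) else 0 := by
    intro i j hij
    have h1 := key i j 1 hij
    have h2 := key i j Complex.I hij
    apply Complex.ext <;> split_ifs with hij' <;> simp [hij'] at h1 h2 ⊢ <;> linarith
  have herm : ∀ i j, M i j = star (M j i) := fun i j => by
    conv_lhs => rw [hM, ← momentMap_conjTranspose]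
    rfl
  ext i j
  rw [Matrix.neg_apply, diagonal_apply]
  rcases le_total j i with hij | hij
  · rw [upper j i hij]
    by_cases hji : i = j
    · subst hji; simp
    · simp [hji, Ne.symm hji]
  · rw [herm, upper i j hij]
    by_cases hji : i = j
    · subst hji; simp
    · simp [hji]

/-- moment-map image / Horn inequalities for quivers.
A dominant integral weight `−λ` lies in the image of the moment map iff the center equation
holds and `Σ_x Σ_{j∈K_x} λ_x(j) ≤ 0` for every `Q`-intersecting family `K`. -/
theorem momentMap_image_iff_horn
    {V A : Type} [Fintype V] [Fintype A] [DecidableEq V] (src tgt : A → V)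
    (hacyc : NoCycles src tgt) (n : V → ℕ)
    (lam : ∀ x : V, Fin (n x) → ℤ) (hlam : ∀ x : V, Antitone (lam x)) :
    (∃ r : ∀ a : A, Matrix (Fin (n (tgt a))) (Fin (n (src a))) ℂ,
        ∀ x : V, momentMap src tgt n r x =
          -(Matrix.diagonal fun j : Fin (n x) => ((lam x j : ℤ) : ℂ))) ↔
      ((∑ x : V, ∑ j : Fin (n x), lam x j) = 0 ∧
       (∀ K : ∀ x : V, Finset (Fin (n x)), IsQIntersecting src tgt n K →
          (∑ x : V, ∑ j ∈ K x, lam x j) ≤ 0)) := by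
  refine ⟨fun ⟨r, hr⟩ => horn_of_momentMap_eq hlam hr, fun ⟨h0, hK⟩ => ?_⟩
  obtain ⟨d, hd⟩ := hacyc.exists_height
  obtain ⟨r, hr⟩ := exists_minimizer (src := src) (tgt := tgt) (l := fun x j => (lam x j : ℝ))
    (fun x i j hij => Int.cast_le.2 (hlam x hij)) (by exact_mod_cast h0)
    (fun K hKI => by exact_mod_cast hK K hKI) hd
  refine ⟨r, fun x => ?_⟩
  simpa using momentMap_eq_of_first_order
    (fun X hX κ hκ => first_order_condition hr hX hκ) x
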